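/- In the TIP alternating-interaction model with m ≥ 1 and n ≥ 0, both agents' trust processes converge in probability: there exist constants t^x, t^y ∈ [0,1] such that for every ε > 0, P(|T^x_k − t^x| > ε) → 0 and P(|T^y_k − t^y| > ε) → 0 as k → ∞. -/

import Mathlib

open MeasureTheory Filter

/-- The Beta(a,b) probability measure on ℝ: the measure supported on (0,1) with density
`x ↦ x^(a−1)·(1−x)^(b−1) / B(a,b)` with respect to Lebesgue measure, where
`B(a,b) = Γ(a)·Γ(b)/Γ(a+b)`. -/
noncomputable def betaMeasure (a b : ℝ) : Measure ℝ :=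
  volume.withDensity fun x =>
    ENNReal.ofReal
      (if 0 < x ∧ x < 1 then
        x ^ (a - 1) * (1 - x) ^ (b - 1) / (Real.Gamma a * Real.Gamma b / Real.Gamma (a + b))
      else 0)

section TipHelpers

open scoped ENNReal

noncomputable def tipDens (a b x : ℝ) : ℝ≥0∞ :=
    ENNReal.ofReal
      (if 0 < x ∧ x < 1 then
        x ^ (a - 1) * (1 - x) ^ (b - 1) / (Real.Gamma a * Real.Gamma b / Real.Gamma (a + b))
      else 0)

lemma tip_gamma_meas : Measurable (fun q : {x : ℝ // 0 < x} => Real.Gamma q.1) := by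
  apply Continuous.measurable
  rw [continuous_iff_continuousAt]
  intro q
  exact ContinuousAt.comp (f := Subtype.val) (x := q) (g := Real.Gamma)
    (Real.differentiableAt_Gamma (fun m h => by
      have h2 := q.2
      have : (0 : ℝ) ≤ m := Nat.cast_nonneg m
      linarith)).continuousAt continuous_subtype_val.continuousAt

lemma tip_dens_lintegral_one {a b : ℝ} (ha : 0 < a) (hb : 0 < b) :
    ∫⁻ x, tipDens a b x = 1 := by
  rw [← ProbabilityTheory.lintegral_betaPDF_eq_one ha hb]
  congr 1
  ext x
  simp only [tipDens, ProbabilityTheory.betaPDF, ProbabilityTheory.betaPDFReal,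
    ProbabilityTheory.beta]
  congr 1
  split_ifs
  · field_simp
  · rfl

lemma tip_dens_meas (a b : ℝ) : Measurable (tipDens a b) := by
  unfold tipDens
  apply ENNReal.measurable_ofReal.comp
  exact Measurable.ite measurableSet_Ioo (by fun_prop) (by fun_prop)

lemma tip_lintegral_beta (a b : ℝ) {f : ℝ → ℝ≥0∞} (hf : Measurable f) :
    ∫⁻ x, f x ∂(betaMeasure a b) = ∫⁻ x, tipDens a b x * f x := by
  exact lintegral_withDensity_eq_lintegral_mul _ (tip_dens_meas a b) hf

lemma tip_mom1 {a b : ℝ} (ha : 0 < a) (hb : 0 < b) :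
    ∫⁻ x, ENNReal.ofReal x ∂(betaMeasure a b) = ENNReal.ofReal (a / (a + b)) := by
  rw [tip_lintegral_beta _ _ ENNReal.measurable_ofReal]
  have h : ∀ x, tipDens a b x * ENNReal.ofReal x
      = ENNReal.ofReal (a / (a + b)) * tipDens (a + 1) b x := by
    intro x
    unfold tipDens
    split_ifs with hx
    · have hG : 0 < Real.Gamma a := Real.Gamma_pos_of_pos ha
      have hGb : 0 < Real.Gamma b := Real.Gamma_pos_of_pos hb
      have hGab : 0 < Real.Gamma (a + b) := Real.Gamma_pos_of_pos (by positivity)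
      have h1 : 0 ≤ x ^ (a - 1) := Real.rpow_nonneg hx.1.le _
      have h2 : 0 ≤ (1 - x) ^ (b - 1) := Real.rpow_nonneg (by linarith [hx.2]) _
      rw [← ENNReal.ofReal_mul (by positivity), ← ENNReal.ofReal_mul (by positivity)]
      congr 1
      rw [show a + 1 + b = (a + b) + 1 by ring, Real.Gamma_add_one (by positivity),
        Real.Gamma_add_one (by positivity), show a + 1 - 1 = (a - 1) + 1 by ring,
        Real.rpow_add_one hx.1.ne']
      field_simp
    · simp
  simp_rw [h]
  rw [lintegral_const_mul _ (tip_dens_meas _ _), tip_dens_lintegral_one (by positivity) hb, mul_one]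

lemma tip_mom2 {a b : ℝ} (ha : 0 < a) (hb : 0 < b) :
    ∫⁻ x, ENNReal.ofReal (x ^ 2) ∂(betaMeasure a b)
      = ENNReal.ofReal (a * (a + 1) / ((a + b) * (a + b + 1))) := by
  rw [tip_lintegral_beta _ _ (by fun_prop)]
  have h : ∀ x, tipDens a b x * ENNReal.ofReal (x ^ 2)
      = ENNReal.ofReal (a * (a + 1) / ((a + b) * (a + b + 1))) * tipDens (a + 2) b x := by
    intro x
    unfold tipDens
    split_ifs with hx
    · have hG : 0 < Real.Gamma a := Real.Gamma_pos_of_pos ha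
      have hGb : 0 < Real.Gamma b := Real.Gamma_pos_of_pos hb
      have hGab : 0 < Real.Gamma (a + b) := Real.Gamma_pos_of_pos (by positivity)
      have h1 : 0 ≤ x ^ (a - 1) := Real.rpow_nonneg hx.1.le _
      have h2 : 0 ≤ (1 - x) ^ (b - 1) := Real.rpow_nonneg (by linarith [hx.2]) _
      rw [← ENNReal.ofReal_mul (by positivity), ← ENNReal.ofReal_mul (by positivity)]
      congr 1
      rw [show a + 2 + b = (a + b + 1) + 1 by ring, Real.Gamma_add_one (by positivity),
        Real.Gamma_add_one (s := a + b) (by positivity), show a + 2 = (a + 1) + 1 by ring,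
        Real.Gamma_add_one (by positivity), Real.Gamma_add_one (by positivity),
        show a + 1 + 1 - 1 = (a - 1) + 1 + 1 by ring,
        Real.rpow_add_one hx.1.ne', Real.rpow_add_one hx.1.ne']
      field_simp
    · simp
  simp_rw [h]
  rw [lintegral_const_mul _ (tip_dens_meas _ _), tip_dens_lintegral_one (by positivity) hb, mul_one]

lemma tip_mass {a b : ℝ} (ha : 0 < a) (hb : 0 < b) : betaMeasure a b Set.univ = 1 := by
  have := tip_lintegral_beta a b (f := fun _ => 1) measurable_const
  simpa [tip_dens_lintegral_one ha hb] using this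

lemma tip_supp {a b : ℝ} : betaMeasure a b (Set.Ioo 0 1)ᶜ = 0 := by
  have h := tip_lintegral_beta a b (f := (Set.Ioo (0 : ℝ) 1)ᶜ.indicator 1)
    (measurable_one.indicator measurableSet_Ioo.compl)
  rw [lintegral_indicator_one measurableSet_Ioo.compl] at h
  rw [h]
  rw [lintegral_eq_zero_iff' (by
    apply AEMeasurable.mul (tip_dens_meas a b).aemeasurable
    exact (measurable_one.indicator measurableSet_Ioo.compl).aemeasurable)]
  filter_upwards with x
  by_cases hx : 0 < x ∧ x < 1
  · have : x ∉ (Set.Ioo (0 : ℝ) 1)ᶜ := fun h => h hx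
    simp [this]
  · simp [tipDens, hx]

variable {Ω : Type*}

lemma tip_meas_lint {G : MeasurableSpace Ω} {a b : Ω → ℝ} (ha : Measurable a) (hb : Measurable b)
    (ha0 : ∀ ω, 0 < a ω) (hb0 : ∀ ω, 0 < b ω) {f : ℝ → ℝ≥0∞} (hf : Measurable f) :
    Measurable fun ω => ∫⁻ x, f x ∂(betaMeasure (a ω) (b ω)) := by
  simp_rw [tip_lintegral_beta _ _ hf]
  have hg : ∀ {c : Ω → ℝ}, Measurable c → (∀ ω, 0 < c ω) →
      Measurable fun ω => Real.Gamma (c ω) := fun {c} hc h0 =>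
    tip_gamma_meas.comp (hc.subtype_mk (h := h0))
  have h1 := hg ha ha0
  have h2 := hg hb hb0
  have h3 := hg (ha.add hb) (fun ω => add_pos (ha0 ω) (hb0 ω))
  simp only [Pi.add_apply] at h3
  apply Measurable.lintegral_prod_right' (f := fun q : Ω × ℝ => tipDens (a q.1) (b q.1) q.2 * f q.2)
  apply Measurable.mul _ (hf.comp measurable_snd)
  unfold tipDens
  apply ENNReal.measurable_ofReal.comp
  apply Measurable.ite (measurableSet_Ioo.preimage measurable_snd)
  · have h1' : Measurable fun q : Ω × ℝ => Real.Gamma (a q.1) := h1.comp measurable_fst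
    have h2' : Measurable fun q : Ω × ℝ => Real.Gamma (b q.1) := h2.comp measurable_fst
    have h3' : Measurable fun q : Ω × ℝ => Real.Gamma (a q.1 + b q.1) := h3.comp measurable_fst
    fun_prop
  · fun_prop

lemma tip_lint_eq {G mΩ : MeasurableSpace Ω} {P : Measure Ω} [IsProbabilityMeasure P]
    (hG : G ≤ mΩ) {T a b : Ω → ℝ} (hT : Measurable T)
    (ha : Measurable[G] a) (hb : Measurable[G] b) (ha0 : ∀ ω, 0 < a ω) (hb0 : ∀ ω, 0 < b ω)
    (h : ∀ A : Set ℝ, MeasurableSet A →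
      P[fun ω => A.indicator (fun _ => (1 : ℝ)) (T ω) | G]
        =ᵐ[P] fun ω => (betaMeasure (a ω) (b ω) A).toReal)
    {s : Set Ω} (hs : MeasurableSet[G] s) {f : ℝ → ℝ≥0∞} (hf : Measurable f) :
    ∫⁻ ω in s, f (T ω) ∂P = ∫⁻ ω in s, ∫⁻ x, f x ∂(betaMeasure (a ω) (b ω)) ∂P := by
  have hM : ∀ {f : ℝ → ℝ≥0∞}, Measurable f →
      Measurable fun ω => ∫⁻ x, f x ∂(betaMeasure (a ω) (b ω)) := fun hf =>
    (tip_meas_lint (G := G) ha hb ha0 hb0 hf).mono hG le_rfl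
  have hC : ∀ {f : ℝ → ℝ≥0∞}, Measurable f → Measurable fun ω => f (T ω) := fun hf => hf.comp hT
  refine Measurable.ennreal_induction (motive := fun f => ∫⁻ ω in s, f (T ω) ∂P =
    ∫⁻ ω in s, ∫⁻ x, f x ∂(betaMeasure (a ω) (b ω)) ∂P) ?_ ?_ ?_ hf
  · intro c A hA
    have hi : Integrable (fun ω => A.indicator (fun _ => (1 : ℝ)) (T ω)) P := by
      refine Integrable.of_bound (C := 1)
        ((measurable_const.indicator hA).comp hT).aestronglyMeasurable ?_
      filter_upwards with ω
      by_cases hx : T ω ∈ A <;> simp [hx]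
    have h1 := setIntegral_condExp hG hi hs
    rw [setIntegral_congr_ae (hG s hs) ((h A hA).mono fun x hx _ => hx)] at h1
    have hm : Measurable fun ω => betaMeasure (a ω) (b ω) A := by
      have := hM (f := A.indicator 1) (measurable_one.indicator hA)
      simpa only [lintegral_indicator_one hA] using this
    have hle : ∀ ω, betaMeasure (a ω) (b ω) A ≤ 1 := fun ω =>
      (measure_mono (Set.subset_univ _)).trans (tip_mass (ha0 ω) (hb0 ω)).le
    rw [integral_toReal hm.aemeasurable
      (Eventually.of_forall fun ω => (hle ω).trans_lt ENNReal.one_lt_top)] at h1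
    have h2 : ∫ ω in s, A.indicator (fun _ => (1 : ℝ)) (T ω) ∂P
        = (∫⁻ ω in s, A.indicator 1 (T ω) ∂P).toReal := by
      rw [← integral_toReal]
      · congr 1
        ext ω
        by_cases hx : T ω ∈ A <;> simp [hx]
      · exact ((measurable_one.indicator hA).comp hT).aemeasurable
      · filter_upwards with ω
        by_cases hx : T ω ∈ A <;> simp [hx]
    rw [h2] at h1
    have hfin : ∀ g : Ω → ℝ≥0∞, (∀ ω, g ω ≤ 1) → ∫⁻ ω in s, g ω ∂P ≠ ∞ := by
      intro g hg
      refine ne_top_of_le_ne_top ENNReal.one_ne_top (b := 1) ?_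
      calc ∫⁻ ω in s, g ω ∂P ≤ ∫⁻ ω in s, 1 ∂P := lintegral_mono hg
        _ ≤ 1 := by simpa using prob_le_one
    have h3 := (ENNReal.toReal_eq_toReal_iff' (hfin _ hle) (hfin _ (fun ω => by
      by_cases hx : T ω ∈ A <;> simp [hx]))).1 h1
    have e1 : ∀ x, A.indicator (fun _ => c) x = c * A.indicator 1 x := by
      intro x
      by_cases hx : x ∈ A <;> simp [hx]
    simp_rw [e1]
    rw [lintegral_const_mul _ (hC (measurable_one.indicator hA)), ← h3]
    simp_rw [lintegral_const_mul _ (measurable_one.indicator hA), lintegral_indicator_one hA]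
    rw [lintegral_const_mul _ hm]
  · intro f g _ hf hg h1 h2
    simp only [Pi.add_apply]
    rw [lintegral_add_left (hC hf), h1, h2]
    simp_rw [lintegral_add_left hf]
    rw [lintegral_add_left (hM hf)]
  · intro f hf hmono hi
    simp only
    rw [lintegral_iSup (fun n => hC (hf n)) (fun i j hij ω => hmono hij _)]
    simp_rw [lintegral_iSup hf hmono]
    rw [lintegral_iSup (fun n => hM (hf n))
      (fun i j hij ω => lintegral_mono (hmono hij))]
    simp_rw [hi]

/-- Moment consequences of a conditional Beta law. -/
structure TipCB (G : MeasurableSpace Ω) {mΩ : MeasurableSpace Ω} (P : Measure Ω)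
    (T a b : Ω → ℝ) : Prop where
  le : G ≤ mΩ
  meas : Measurable T
  am : Measurable[G] a
  bm : Measurable[G] b
  apos : ∀ ω, 0 < a ω
  bpos : ∀ ω, 0 < b ω
  supp : ∀ᵐ ω ∂P, 0 < T ω ∧ T ω < 1
  mean : ∀ W : Ω → ℝ, Measurable[G] W → Integrable W P →
    ∫ ω, W ω * (T ω - a ω / (a ω + b ω)) ∂P = 0
  var : ∀ W : Ω → ℝ, Measurable[G] W → Integrable W P →
    ∫ ω, W ω * (T ω - a ω / (a ω + b ω)) ^ 2 ∂P =
      ∫ ω, W ω * (a ω * b ω / ((a ω + b ω) ^ 2 * (a ω + b ω + 1))) ∂P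

lemma tip_ce {G mΩ : MeasurableSpace Ω} {P : Measure Ω} [IsProbabilityMeasure P]
    (hG : G ≤ mΩ) {X m : Ω → ℝ} (hX : Measurable X)
    (hX1 : ∀ᵐ ω ∂P, 0 ≤ X ω ∧ X ω ≤ 1) (hm : Measurable[G] m) (hm1 : ∀ ω, 0 ≤ m ω ∧ m ω ≤ 1)
    (h : ∀ s, MeasurableSet[G] s →
      ∫⁻ ω in s, ENNReal.ofReal (X ω) ∂P = ∫⁻ ω in s, ENNReal.ofReal (m ω) ∂P)
    (W : Ω → ℝ) (hW : Measurable[G] W) (hWi : Integrable W P) :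
    ∫ ω, W ω * X ω ∂P = ∫ ω, W ω * m ω ∂P := by
  have hXi : Integrable X P := by
    refine Integrable.of_bound (C := 1) hX.aestronglyMeasurable ?_
    filter_upwards [hX1] with ω hω
    rw [Real.norm_eq_abs, abs_le]; constructor <;> linarith [hω.1, hω.2]
  have hmi : Integrable m P := by
    refine Integrable.of_bound (C := 1) (hm.mono hG le_rfl).aestronglyMeasurable ?_
    filter_upwards with ω
    rw [Real.norm_eq_abs, abs_le]; constructor <;> linarith [(hm1 ω).1, (hm1 ω).2]
  have key : m =ᵐ[P] P[X | G] := by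
    refine ae_eq_condExp_of_forall_setIntegral_eq hG hXi (fun _ _ _ => hmi.integrableOn) ?_
      hm.stronglyMeasurable.aestronglyMeasurable
    intro s hs _
    rw [integral_eq_lintegral_of_nonneg_ae (Eventually.of_forall fun ω => (hm1 ω).1)
      (hm.mono hG le_rfl).aestronglyMeasurable,
      integral_eq_lintegral_of_nonneg_ae (ae_restrict_of_ae (hX1.mono fun ω h => h.1))
      hX.aestronglyMeasurable, h s hs]
  have hWX : Integrable (W * X) P := by
    refine hWi.mul_bdd (c := 1) hX.aestronglyMeasurable ?_
    filter_upwards [hX1] with ω hω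
    rw [Real.norm_eq_abs, abs_le]; constructor <;> linarith [hω.1, hω.2]
  have h2 := condExp_mul_of_stronglyMeasurable_left (m := G) hW.stronglyMeasurable hWX hXi
  have h3 : ∫ ω, (W * X) ω ∂P = ∫ ω, W ω * m ω ∂P := by
    rw [← integral_condExp hG]
    apply integral_congr_ae
    filter_upwards [h2, key] with ω h2 hk
    rw [h2, Pi.mul_apply, hk]
  exact h3

lemma tip_cb {G mΩ : MeasurableSpace Ω} {P : Measure Ω} [IsProbabilityMeasure P]
    (hG : G ≤ mΩ) {T a b : Ω → ℝ} (hT : Measurable T)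
    (ha : Measurable[G] a) (hb : Measurable[G] b) (ha0 : ∀ ω, 0 < a ω) (hb0 : ∀ ω, 0 < b ω)
    (h : ∀ A : Set ℝ, MeasurableSet A →
      P[fun ω => A.indicator (fun _ => (1 : ℝ)) (T ω) | G]
        =ᵐ[P] fun ω => (betaMeasure (a ω) (b ω) A).toReal) : TipCB G P T a b := by
  have hL := fun {s : Set Ω} (hs : MeasurableSet[G] s) {f : ℝ → ℝ≥0∞} (hf : Measurable f) =>
    tip_lint_eq hG hT ha hb ha0 hb0 h hs hf
  have hsupp : ∀ᵐ ω ∂P, 0 < T ω ∧ T ω < 1 := by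
    have h1 := hL MeasurableSet.univ (f := (Set.Ioo (0 : ℝ) 1)ᶜ.indicator 1)
      (measurable_one.indicator measurableSet_Ioo.compl)
    simp_rw [lintegral_indicator_one measurableSet_Ioo.compl, tip_supp] at h1
    simp only [Measure.restrict_univ, lintegral_zero] at h1
    replace h1 := (lintegral_eq_zero_iff ((measurable_one.indicator measurableSet_Ioo.compl).comp hT)).1 h1
    filter_upwards [h1] with ω hω
    by_contra hc
    have : T ω ∈ (Set.Ioo (0 : ℝ) 1)ᶜ := hc
    simp [this] at hω
  have M1 := tip_ce hG (X := T) (m := fun ω => a ω / (a ω + b ω)) hT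
    (hsupp.mono fun ω h => ⟨h.1.le, h.2.le⟩) (ha.div (ha.add hb)) (fun ω => by
      have := ha0 ω; have := hb0 ω
      exact ⟨by positivity, by rw [div_le_one (by positivity)]; linarith⟩) (fun s hs => by
      rw [hL hs ENNReal.measurable_ofReal]
      simp_rw [tip_mom1 (ha0 _) (hb0 _)])
  have M2 := tip_ce hG (X := fun ω => T ω ^ 2)
    (m := fun ω => a ω * (a ω + 1) / ((a ω + b ω) * (a ω + b ω + 1))) (hT.pow_const 2)
    (hsupp.mono fun ω h => ⟨by positivity, by nlinarith [h.1, h.2]⟩) (by fun_prop) (fun ω => by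
      have := ha0 ω; have := hb0 ω
      exact ⟨by positivity, by rw [div_le_one (by positivity)]; nlinarith⟩) (fun s hs => by
      rw [hL hs (f := fun x => ENNReal.ofReal (x ^ 2)) (by fun_prop)]
      simp_rw [tip_mom2 (ha0 _) (hb0 _)])
  have hmu1 : ∀ ω, 0 ≤ a ω / (a ω + b ω) ∧ a ω / (a ω + b ω) ≤ 1 := fun ω => by
      have := ha0 ω; have := hb0 ω
      exact ⟨by positivity, by rw [div_le_one (by positivity)]; linarith⟩
  have hmum : Measurable[G] fun ω => a ω / (a ω + b ω) := ha.div (ha.add hb)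
  have IB : ∀ (W X : Ω → ℝ), Integrable W P → Measurable X → (∀ᵐ ω ∂P, 0 ≤ X ω ∧ X ω ≤ 1) →
      Integrable (fun ω => W ω * X ω) P := by
    intro W X hW hX h1
    refine hW.mul_bdd (c := 1) hX.aestronglyMeasurable ?_
    filter_upwards [h1] with ω hω
    rw [Real.norm_eq_abs, abs_le]; constructor <;> linarith [hω.1, hω.2]
  have hT1 : ∀ᵐ ω ∂P, 0 ≤ T ω ∧ T ω ≤ 1 := hsupp.mono fun ω h => ⟨h.1.le, h.2.le⟩
  refine ⟨hG, hT, ha, hb, ha0, hb0, hsupp, ?_, ?_⟩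
  · intro W hW hWi
    simp_rw [mul_sub]
    rw [integral_sub (IB W T hWi hT hT1) (IB W _ hWi (hmum.mono hG le_rfl) (.of_forall hmu1)),
      M1 W hW hWi, sub_self]
  · intro W hW hWi
    have hWmu : Integrable (fun ω => W ω * (a ω / (a ω + b ω))) P :=
      IB W _ hWi (hmum.mono hG le_rfl) (.of_forall hmu1)
    have e1 := M2 W hW hWi
    have e2 := M1 (fun ω => W ω * (a ω / (a ω + b ω))) (hW.mul hmum) hWmu
    have hT2 : ∀ᵐ ω ∂P, 0 ≤ T ω ^ 2 ∧ T ω ^ 2 ≤ 1 :=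
      hsupp.mono fun ω h => ⟨by positivity, by nlinarith [h.1, h.2]⟩
    have i1 := IB W (fun ω => T ω ^ 2) hWi (hT.pow_const 2) hT2
    have i2 := IB _ T hWmu hT hT1
    have i3 := IB _ _ hWmu (hmum.mono hG le_rfl) (.of_forall hmu1)
    have i4 : Integrable (fun ω => W ω * (a ω * (a ω + 1) / ((a ω + b ω) * (a ω + b ω + 1)))) P := by
      refine IB W _ hWi ?_ (.of_forall fun ω => ?_)
      · have := ha.mono hG le_rfl; have := hb.mono hG le_rfl; fun_prop
      · have := ha0 ω; have := hb0 ω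
        exact ⟨by positivity, by rw [div_le_one (by positivity)]; nlinarith⟩
    calc ∫ ω, W ω * (T ω - a ω / (a ω + b ω)) ^ 2 ∂P
        = ∫ ω, (W ω * T ω ^ 2 - 2 * (W ω * (a ω / (a ω + b ω)) * T ω)
          + W ω * (a ω / (a ω + b ω)) * (a ω / (a ω + b ω))) ∂P := by
          congr 1; ext ω; ring
      _ = ∫ ω, (W ω * (a ω * (a ω + 1) / ((a ω + b ω) * (a ω + b ω + 1)))
          - 2 * (W ω * (a ω / (a ω + b ω)) * (a ω / (a ω + b ω)))
          + W ω * (a ω / (a ω + b ω)) * (a ω / (a ω + b ω))) ∂P := by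
          have j1 : Integrable (fun ω => W ω * T ω ^ 2
            - 2 * (W ω * (a ω / (a ω + b ω)) * T ω)) P := i1.sub (i2.const_mul 2)
          have j2 : Integrable (fun ω => W ω * (a ω * (a ω + 1) / ((a ω + b ω) * (a ω + b ω + 1)))
            - 2 * (W ω * (a ω / (a ω + b ω)) * (a ω / (a ω + b ω)))) P := i4.sub (i3.const_mul 2)
          rw [integral_add j1 i3, integral_sub i1 (i2.const_mul 2),
            integral_const_mul, e1, e2, integral_add j2 i3,
            integral_sub i4 (i3.const_mul 2), integral_const_mul]
      _ = _ := by
          congr 1; ext ω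
          have := ha0 ω; have := hb0 ω
          field_simp
          ring

lemma TipCB.swap {G mΩ : MeasurableSpace Ω} {P : Measure Ω}
    {T a b : Ω → ℝ} (h : TipCB G P T a b) :
    TipCB G P (fun ω => 1 - T ω) b a := by
  have e : ∀ ω, 1 - T ω - b ω / (b ω + a ω) = -(T ω - a ω / (a ω + b ω)) := by
    intro ω
    have := h.apos ω; have := h.bpos ω
    field_simp
    ring
  refine ⟨h.le, measurable_const.sub h.meas, h.bm, h.am, h.bpos, h.apos, ?_, ?_, ?_⟩
  · filter_upwards [h.supp] with ω hω
    constructor <;> linarith [hω.1, hω.2]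
  · intro W hW hi
    simp_rw [e, mul_neg, integral_neg, h.mean W hW hi, neg_zero]
  · intro W hW hi
    simp_rw [e, neg_sq, h.var W hW hi, add_comm (b _) (a _), mul_comm (b _) (a _)]

lemma tip_var_le {a b : ℝ} (ha : 0 < a) (hb : 0 < b) :
    a * b / ((a + b) ^ 2 * (a + b + 1)) ≤ 1 / (a + b) := by
  rw [div_le_div_iff₀ (by positivity) (by positivity)]
  have : 0 < a * b := by positivity
  nlinarith [sq_nonneg (a - b), mul_pos (add_pos ha hb) this, sq_nonneg (a + b)]

lemma tip_kron {e N : ℕ → ℝ} (he : ∀ i, 0 ≤ e i) (hN : ∀ i, 0 < N i) (hmono : Monotone N)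
    (hlim : Tendsto N atTop atTop) (hs : Summable fun i => e i / N i) :
    Tendsto (fun k => (∑ i ∈ Finset.range k, e i) / N k) atTop (nhds 0) := by
  have key : Tendsto (fun k => ∑' i, (if i < k then e i / N k else 0)) atTop
      (nhds (∑' _ : ℕ, (0 : ℝ))) := by
    apply tendsto_tsum_of_dominated_convergence (bound := fun i => e i / N i) hs
    · intro i
      have h1 : Tendsto (fun k => e i / N k) atTop (nhds 0) := hlim.const_div_atTop (e i)
      refine h1.congr' ?_
      filter_upwards [eventually_gt_atTop i] with k hk
      simp [hk]
    · refine Eventually.of_forall fun k i => ?_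
      split_ifs with h
      · rw [Real.norm_of_nonneg (div_nonneg (he i) (hN k).le)]
        exact div_le_div_of_nonneg_left (he i) (hN i) (hmono h.le)
      · simpa using div_nonneg (he i) (hN i).le
  rw [tsum_zero] at key
  refine key.congr fun k => ?_
  rw [tsum_eq_sum (s := Finset.range k)]
  · rw [Finset.sum_div]
    refine Finset.sum_congr rfl fun i hi => ?_
    simp [Finset.mem_range.1 hi]
  · intro i hi
    simp only [Finset.mem_range] at hi
    simp [hi]

lemma tip_as_summable {mΩ : MeasurableSpace Ω} {P : Measure Ω} {f : ℕ → Ω → ℝ}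
    (h0 : ∀ k, 0 ≤ᵐ[P] f k) (hi : ∀ k, Integrable (f k) P)
    (hs : Summable fun k => ∫ ω, f k ω ∂P) : ∀ᵐ ω ∂P, Summable fun k => f k ω := by
  have h1 : ∫⁻ ω, ∑' k, ENNReal.ofReal (f k ω) ∂P ≠ ∞ := by
    rw [lintegral_tsum (fun k => (hi k).1.aemeasurable.ennreal_ofReal)]
    have : ∀ k, ∫⁻ ω, ENNReal.ofReal (f k ω) ∂P = ENNReal.ofReal (∫ ω, f k ω ∂P) := fun k =>
      (ofReal_integral_eq_lintegral_ofReal (hi k) (h0 k)).symm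
    simp_rw [this]
    exact hs.tsum_ofReal_ne_top
  have h2 := ae_lt_top' (AEMeasurable.tsum (fun k => (hi k).1.aemeasurable.ennreal_ofReal)) h1
  filter_upwards [h2, ae_all_iff.2 h0] with ω hω hω0
  have := ENNReal.summable_toReal hω.ne
  refine this.congr fun k => ?_
  exact (ENNReal.toReal_ofReal (hω0 k))

lemma tip_det {Z D E N : ℕ → ℝ} {C C0 : ℝ} {K : ℕ}
    (h1 : ∀ k, K ≤ k → 0 ≤ Z k → Z (k + 1) ≤ Z k + D k + E k)
    (h2 : ∀ k, K ≤ k → Z k < 0 → Z (k + 1) ≤ C)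
    (hK : Z K ≤ C) (hE : ∀ k, 0 ≤ E k)
    (hD : ∀ j k, j ≤ k → ∑ i ∈ Finset.range k, D i - ∑ i ∈ Finset.range j, D i ≤ C0)
    (hlim : Tendsto N atTop atTop)
    (hEN : Tendsto (fun k => (∑ i ∈ Finset.range k, E i) / N k) atTop (nhds 0)) :
    ∀ η > 0, ∀ᶠ k in atTop, Z k ≤ η * N k := by
  have hE' : ∀ k, 0 ≤ ∑ i ∈ Finset.range k, E i := fun k => Finset.sum_nonneg fun i _ => hE i
  have key : ∀ k, K ≤ k → ∃ j, j ≤ k ∧ Z k ≤ C + (∑ i ∈ Finset.range k, D i -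
      ∑ i ∈ Finset.range j, D i) + ∑ i ∈ Finset.range k, E i := by
    intro k hk
    induction k, hk using Nat.le_induction with
    | base => exact ⟨K, le_rfl, by linarith [hE' K]⟩
    | succ k hk ih =>
      obtain ⟨j, hj, hjk⟩ := ih
      by_cases h : 0 ≤ Z k
      · refine ⟨j, by omega, ?_⟩
        rw [Finset.sum_range_succ, Finset.sum_range_succ]
        linarith [h1 k hk h]
      · refine ⟨k + 1, le_rfl, ?_⟩
        linarith [h2 k hk (not_le.1 h), hE' (k + 1)]
  intro η hη
  filter_upwards [hEN.eventually (gt_mem_nhds (half_pos hη)), eventually_ge_atTop K,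
    hlim.eventually_gt_atTop 0, hlim.eventually_ge_atTop ((C + C0) / (η / 2))] with k hk1 hk2 hk3 hk4
  obtain ⟨j, hj, hjk⟩ := key k hk2
  rw [div_lt_iff₀ hk3] at hk1
  rw [div_le_iff₀ (half_pos hη)] at hk4
  linarith [hD j k hj]

lemma tip_inprob {mΩ : MeasurableSpace Ω} {P : Measure Ω} [IsProbabilityMeasure P]
    {G : ℕ → MeasurableSpace Ω} {T a b : ℕ → Ω → ℝ} {t c : ℝ} (hc : 0 < c)
    (h : ∀ k, 1 ≤ k → TipCB (G k) P (T k) (a k) (b k))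
    (hN : ∀ k ω, 1 ≤ k → c ≤ a k ω + b k ω)
    (hlim : ∀ᵐ ω ∂P, Tendsto (fun k => a k ω + b k ω) atTop atTop)
    (hmu : ∀ᵐ ω ∂P, Tendsto (fun k => a k ω / (a k ω + b k ω)) atTop (nhds t)) :
    ∀ ε > 0, Tendsto (fun k => P {ω | ε < |T k ω - t|}) atTop (nhds 0) := by
  have hm : ∀ k, 1 ≤ k → Measurable (a k) ∧ Measurable (b k) := fun k hk =>
    ⟨(h k hk).am.mono (h k hk).le le_rfl, (h k hk).bm.mono (h k hk).le le_rfl⟩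
  -- bound on second moment
  have hint : ∀ k, 1 ≤ k → Integrable (fun ω => 1 / (a k ω + b k ω)) P := fun k hk => by
    refine Integrable.of_bound (C := 1 / c) ?_ (Eventually.of_forall fun ω => ?_)
    · exact (measurable_const.div ((hm k hk).1.add (hm k hk).2)).aestronglyMeasurable
    · have := hN k ω hk
      rw [Real.norm_of_nonneg (by have := hc.trans_le this; positivity)]
      exact one_div_le_one_div_of_le hc this
  have h0 : Tendsto (fun k => ∫ ω, 1 / (a (k + 1) ω + b (k + 1) ω) ∂P) atTop (nhds 0) := by
    have := tendsto_integral_of_dominated_convergence (μ := P)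
      (F := fun k ω => 1 / (a (k + 1) ω + b (k + 1) ω)) (f := fun _ => (0 : ℝ))
      (fun _ => 1 / c) (fun k => (hint (k + 1) (by omega)).1) (integrable_const _) (fun k => by
        refine Eventually.of_forall fun ω => ?_
        have := hN (k + 1) ω (by omega)
        rw [Real.norm_of_nonneg (by have := hc.trans_le this; positivity)]
        exact one_div_le_one_div_of_le hc this) (by
        filter_upwards [hlim] with ω hω
        have := (hω.comp (tendsto_add_atTop_nat 1)).const_div_atTop 1
        exact this)
    simpa using this
  have hsq : ∀ k, 1 ≤ k → Integrable (fun ω => (T k ω - a k ω / (a k ω + b k ω)) ^ 2) P ∧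
      ∫ ω, (T k ω - a k ω / (a k ω + b k ω)) ^ 2 ∂P ≤ ∫ ω, 1 / (a k ω + b k ω) ∂P := by
    intro k hk
    have H := h k hk
    refine ⟨?_, ?_⟩
    · refine Integrable.of_bound (C := 1) ?_ ?_
      · exact ((H.meas.sub ((hm k hk).1.div ((hm k hk).1.add
          (hm k hk).2))).pow_const 2).aestronglyMeasurable
      · filter_upwards [H.supp] with ω hω
        have ha := H.apos ω
        have hb := H.bpos ω
        have h1 : 0 ≤ a k ω / (a k ω + b k ω) := by positivity
        have h2 : a k ω / (a k ω + b k ω) ≤ 1 := by rw [div_le_one (by positivity)]; linarith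
        rw [Real.norm_of_nonneg (sq_nonneg _)]
        rw [sq_le_one_iff_abs_le_one, abs_le]
        constructor <;> linarith [hω.1, hω.2]
    · have := H.var (fun _ => 1) measurable_const (integrable_const _)
      simp only [one_mul] at this
      rw [this]
      refine integral_mono_of_nonneg (Eventually.of_forall fun ω => ?_) (hint k hk)
        (Eventually.of_forall fun ω => ?_)
      · have ha := H.apos ω
        have hb := H.bpos ω
        simp only [Pi.zero_apply]
        positivity
      · exact tip_var_le (H.apos ω) (H.bpos ω)
  intro ε hε
  have hmeas2 : TendstoInMeasure P (fun k ω => a (k + 1) ω / (a (k + 1) ω + b (k + 1) ω)) atTop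
      (fun _ => t) := by
    apply tendstoInMeasure_of_tendsto_ae
    · intro k
      exact ((hm (k + 1) (by omega)).1.div ((hm (k + 1) (by omega)).1.add
        (hm (k + 1) (by omega)).2)).aestronglyMeasurable
    · filter_upwards [hmu] with ω hω
      exact hω.comp (tendsto_add_atTop_nat 1)
  rw [tendstoInMeasure_iff_dist] at hmeas2
  have hm2 := hmeas2 (ε / 2) (half_pos hε)
  have hm1 : Tendsto (fun k => ENNReal.ofReal ((∫ ω, 1 / (a (k + 1) ω + b (k + 1) ω) ∂P) / (ε / 2) ^ 2))
      atTop (nhds 0) := by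
    have := (ENNReal.tendsto_ofReal (h0.div_const ((ε / 2) ^ 2)))
    simpa using this
  have hsum := hm1.add hm2
  rw [add_zero] at hsum
  rw [← tendsto_add_atTop_iff_nat 1]
  refine tendsto_of_tendsto_of_tendsto_of_le_of_le tendsto_const_nhds hsum (fun _ => zero_le) ?_
  intro k
  have hk : 1 ≤ k + 1 := by omega
  have hmark : P {ω | (ε / 2) ^ 2 ≤ (T (k + 1) ω - a (k + 1) ω / (a (k + 1) ω + b (k + 1) ω)) ^ 2}
      ≤ ENNReal.ofReal ((∫ ω, 1 / (a (k + 1) ω + b (k + 1) ω) ∂P) / (ε / 2) ^ 2) := by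
    have := mul_meas_ge_le_integral_of_nonneg (μ := P)
      (Eventually.of_forall fun ω => sq_nonneg (T (k + 1) ω - a (k + 1) ω / (a (k + 1) ω + b (k + 1) ω)))
      (hsq (k + 1) hk).1 ((ε / 2) ^ 2)
    rw [ENNReal.le_ofReal_iff_toReal_le (measure_ne_top _ _)]
    · rw [le_div_iff₀ (by positivity), mul_comm]
      exact this.trans (hsq (k + 1) hk).2
    · apply div_nonneg _ (by positivity)
      apply integral_nonneg
      intro ω
      have := hc.trans_le (hN (k + 1) ω hk)
      simp only [Pi.zero_apply]
      positivity
  refine (measure_mono ?_).trans ((measure_union_le _ _).trans (add_le_add_left hmark _))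
  intro ω hω
  simp only [Set.mem_setOf_eq, Set.mem_union] at hω ⊢
  by_contra hcon
  push Not at hcon
  obtain ⟨c1, c2⟩ := hcon
  have c1' := abs_lt_of_sq_lt_sq c1 (half_pos hε).le
  rw [Real.dist_eq] at c2
  have := abs_add_le (T (k + 1) ω - a (k + 1) ω / (a (k + 1) ω + b (k + 1) ω))
    (a (k + 1) ω / (a (k + 1) ω + b (k + 1) ω) - t)
  rw [sub_add_sub_cancel] at this
  linarith

noncomputable def tipF (d e s f c1 c2 q w : ℝ) : ℝ :=
  d * ((1 - q) * s - q * f) + e * ((1 - q) * c1 * max (w - q) 0 - q * c2 * max (q - w) 0)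

lemma tipF_swap (d e s f c1 c2 q w : ℝ) :
    tipF d e f s c2 c1 (1 - q) (1 - w) = - tipF d e s f c1 c2 q w := by
  unfold tipF
  rw [show 1 - w - (1 - q) = q - w by ring, show 1 - q - (1 - w) = w - q by ring]
  ring

lemma tip_cmp {d e s f c1 c2 U V L K : ℝ} (hd : 0 < d) (he : 0 ≤ e) (hs : 0 < s) (hf : 0 < f)
    (hc1 : 0 < c1) (hc2 : 0 < c2) (hU1 : U ≤ 1) (hL0 : 0 ≤ L)
    (h1 : 0 ≤ tipF d e s f c1 c2 U V) (h2 : tipF d e s f c1 c2 L K ≤ 0) (h : V - K ≤ U - L) :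
    U ≤ L := by
  by_contra hcon
  push Not at hcon
  unfold tipF at h1 h2
  have e1 : d * ((1 - U) * s - U * f) < d * ((1 - L) * s - L * f) := by
    apply mul_lt_mul_of_pos_left _ hd
    nlinarith
  have e2 : (1 - U) * c1 * max (V - U) 0 ≤ (1 - L) * c1 * max (K - L) 0 := by
    apply mul_le_mul
    · exact mul_le_mul_of_nonneg_right (by linarith) hc1.le
    · exact max_le_max (by linarith) le_rfl
    · exact le_max_right _ _
    · exact mul_nonneg (by linarith) hc1.le
  have e3 : L * c2 * max (L - K) 0 ≤ U * c2 * max (U - V) 0 := by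
    apply mul_le_mul
    · exact mul_le_mul_of_nonneg_right (by linarith) hc2.le
    · exact max_le_max (by linarith) le_rfl
    · exact le_max_right _ _
    · exact mul_nonneg (by linarith) hc2.le
  have e4 := mul_le_mul_of_nonneg_left (sub_le_sub e2 e3) he
  linarith

/-- deterministic data of one agent -/
structure TipAg (d e s f c1 c2 : ℝ) (isD : ℕ → Prop) (a b u v ν : ℕ → ℝ) : Prop where
  hd : 0 < d
  he : 0 ≤ e
  hs : 0 < s
  hf : 0 < f
  hc1 : 0 < c1
  hc2 : 0 < c2
  ha : ∀ k, 0 < a k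
  hb : ∀ k, 0 < b k
  dir : ∀ k, isD k → a (k + 1) = a k + s ∧ b (k + 1) = b k + f
  ind : ∀ k, ¬ isD k → a (k + 1) = a k + c1 * max (v (k + 1) - u k) 0 ∧
    b (k + 1) = b k + c2 * max (u k - v (k + 1)) 0
  hu : ∀ k, 1 ≤ k → 0 ≤ u k ∧ u k ≤ 1
  hv : ∀ k, 1 ≤ k → 0 ≤ v k ∧ v k ≤ 1
  hν : ∀ k, 0 ≤ ν k ∧ ν k ≤ 1
  lim : Tendsto (fun k => a k + b k) atTop atTop
  noise : Tendsto (fun k => (∑ i ∈ Finset.range k, (|u i - a i / (a i + b i)| +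
    |v (i + 1) - ν (i + 1)|)) / (a k + b k)) atTop (nhds 0)
  per : ∀ (D : ℕ → ℝ) (g h : ℝ), (∀ i, isD i → D i = g) → (∀ i, ¬ isD i → D i = h) →
    d * g + e * h ≤ 0 → ∃ C0, ∀ j k, j ≤ k →
      ∑ i ∈ Finset.range k, D i - ∑ i ∈ Finset.range j, D i ≤ C0

lemma TipAg.swap {d e s f c1 c2 : ℝ} {isD : ℕ → Prop} {a b u v ν : ℕ → ℝ}
    (H : TipAg d e s f c1 c2 isD a b u v ν) :
    TipAg d e f s c2 c1 isD b a (fun k => 1 - u k) (fun k => 1 - v k) (fun k => 1 - ν k) where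
  hd := H.hd
  he := H.he
  hs := H.hf
  hf := H.hs
  hc1 := H.hc2
  hc2 := H.hc1
  ha := H.hb
  hb := H.ha
  dir k hk := ⟨(H.dir k hk).2, (H.dir k hk).1⟩
  ind k hk := by
    have := H.ind k hk
    constructor
    · rw [this.2]; congr 3; ring
    · rw [this.1]; congr 3; ring
  hu k hk := by have := H.hu k hk; constructor <;> linarith
  hv k hk := by have := H.hv k hk; constructor <;> linarith
  hν k := by have := H.hν k; constructor <;> linarith
  lim := by simpa only [add_comm] using H.lim
  noise := by
    refine H.noise.congr fun k => ?_
    rw [add_comm (a k)]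
    congr 1
    refine Finset.sum_congr rfl fun i _ => ?_
    have h1 : b i / (b i + a i) = 1 - a i / (a i + b i) := by
      have := H.ha i
      have := H.hb i
      field_simp
      ring
    rw [h1, ← abs_neg (u i - _), ← abs_neg (v (i + 1) - _)]
    congr 2 <;> ring
  per := H.per

lemma TipAg.upper {d e s f c1 c2 : ℝ} {isD : ℕ → Prop} {a b u v ν : ℕ → ℝ}
    (H : TipAg d e s f c1 c2 isD a b u v ν) {q w : ℝ} (hq0 : 0 ≤ q) (hq1 : q ≤ 1)
    (hw : ∀ᶠ k in atTop, ν k ≤ w) (hF : tipF d e s f c1 c2 q w ≤ 0) :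
    ∀ η > 0, ∀ᶠ k in atTop, a k / (a k + b k) ≤ q + η := by
  classical
  obtain ⟨K0, hK0⟩ := eventually_atTop.1 hw
  set K := K0 + 1
  obtain ⟨hd, he, hs, hf, hc1, hc2, ha, hb, dir, ind, hu, hv, hν, lim, noise, per⟩ := H
  set D : ℕ → ℝ := fun i => if isD i then (1 - q) * s - q * f else
    (1 - q) * c1 * max (w - q) 0 - q * c2 * max (q - w) 0 with hD
  obtain ⟨C0, hC0⟩ := per D _ _ (fun i hi => if_pos hi) (fun i hi => if_neg hi) hF
  have q1 : 0 ≤ (1 - q) * c1 := mul_nonneg (by linarith) hc1.le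
  have q2 : 0 ≤ q * c2 := mul_nonneg hq0 hc2.le
  have q3 : (1 - q) * c1 ≤ c1 := mul_le_of_le_one_left hc1.le (by linarith)
  have q4 : q * c2 ≤ c2 := mul_le_of_le_one_left hc2.le (by linarith)
  have hE := noise.const_mul (c1 + c2)
  rw [mul_zero] at hE
  have hmain := tip_det (Z := fun k => (1 - q) * a k - q * b k) (D := D)
    (E := fun i => (c1 + c2) * (|u i - a i / (a i + b i)| + |v (i + 1) - ν (i + 1)|))
    (N := fun k => a k + b k) (C := max ((1 - q) * a K - q * b K) (s + c1)) (C0 := C0) (K := K)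
    (by
      intro k hk hZ
      by_cases h : isD k
      · obtain ⟨h1, h2⟩ := dir k h
        rw [h1, h2]
        have : D k = (1 - q) * s - q * f := if_pos h
        rw [this]
        have : 0 ≤ (c1 + c2) * (|u k - a k / (a k + b k)| + |v (k + 1) - ν (k + 1)|) := by
          positivity
        linarith
      · obtain ⟨h1, h2⟩ := ind k h
        rw [h1, h2]
        have : D k = (1 - q) * c1 * max (w - q) 0 - q * c2 * max (q - w) 0 := if_neg h
        rw [this]
        set ee := |u k - a k / (a k + b k)| + |v (k + 1) - ν (k + 1)| with hee
        have hee0 : 0 ≤ ee := by positivity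
        have hmu : q ≤ a k / (a k + b k) := by
          rw [le_div_iff₀ (by linarith [ha k, hb k])]
          linarith
        have hdiff : v (k + 1) - u k ≤ (w - q) + ee := by
          have := hK0 (k + 1) (by omega)
          have := neg_abs_le (u k - a k / (a k + b k))
          have := le_abs_self (v (k + 1) - ν (k + 1))
          linarith
        have m1 : max (v (k + 1) - u k) 0 ≤ max (w - q) 0 + ee := by
          apply max_le
          · linarith [le_max_left (w - q) 0]
          · linarith [le_max_right (w - q) 0]
        have m2 : max (q - w) 0 ≤ max (u k - v (k + 1)) 0 + ee := by
          apply max_le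
          · linarith [le_max_left (u k - v (k + 1)) 0]
          · linarith [le_max_right (u k - v (k + 1)) 0]
        have n1 := mul_le_mul_of_nonneg_left m1 q1
        have n2 := mul_le_mul_of_nonneg_left m2 q2
        have n3 := mul_le_mul_of_nonneg_right q3 hee0
        have n4 := mul_le_mul_of_nonneg_right q4 hee0
        linarith)
    (by
      intro k hk hZ
      refine le_trans ?_ (le_max_right _ _)
      by_cases h : isD k
      · obtain ⟨h1, h2⟩ := dir k h
        rw [h1, h2]
        have : (1 - q) * s ≤ s := mul_le_of_le_one_left hs.le (by linarith)
        have : 0 ≤ q * f := mul_nonneg hq0 hf.le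
        linarith
      · obtain ⟨h1, h2⟩ := ind k h
        rw [h1, h2]
        have m1 : max (v (k + 1) - u k) 0 ≤ 1 :=
          max_le (by linarith [hv (k + 1) (by omega), hu k (by omega)]) zero_le_one
        have n1 := mul_le_mul_of_nonneg_left m1 q1
        have n2 := mul_nonneg q2 (le_max_right (u k - v (k + 1)) 0)
        linarith)
    (le_max_left _ _)
    (fun k => by positivity)
    hC0 lim
    (by
      refine hE.congr fun k => ?_
      rw [← mul_div_assoc, Finset.mul_sum])
  intro η hη
  filter_upwards [hmain η hη] with k hk
  rw [div_le_iff₀ (by linarith [ha k, hb k])]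
  linarith

lemma tip_limsup_lt {x : ℕ → ℝ} (h : ∀ k, 0 ≤ x k ∧ x k ≤ 1) {c : ℝ}
    (hc : limsup x atTop < c) : ∀ᶠ k in atTop, x k < c := by
  exact eventually_lt_of_limsup_lt hc (isBoundedUnder_of ⟨1, fun k => (h k).2⟩)

lemma tip_limsup_le {x : ℕ → ℝ} (h : ∀ k, 0 ≤ x k ∧ x k ≤ 1) {c : ℝ}
    (hc : ∀ᶠ k in atTop, x k ≤ c) : limsup x atTop ≤ c := by
  exact limsup_le_of_le ((isBoundedUnder_of ⟨0, fun k => (h k).1⟩ :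
    IsBoundedUnder (· ≥ ·) atTop x).isCoboundedUnder_le) hc

lemma tip_limsup_mem {x : ℕ → ℝ} (h : ∀ k, 0 ≤ x k ∧ x k ≤ 1) :
    0 ≤ limsup x atTop ∧ limsup x atTop ≤ 1 := by
  refine ⟨?_, tip_limsup_le h (Eventually.of_forall fun k => (h k).2)⟩
  by_contra hcon
  push Not at hcon
  obtain ⟨k, hk⟩ := (tip_limsup_lt h hcon).exists
  linarith [(h k).1]

lemma tip_mu_mem {a b : ℕ → ℝ} (ha : ∀ k, 0 < a k) (hb : ∀ k, 0 < b k) (k : ℕ) :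
    0 ≤ a k / (a k + b k) ∧ a k / (a k + b k) ≤ 1 := by
  have := ha k
  have := hb k
  refine ⟨by positivity, ?_⟩
  rw [div_le_one (by positivity)]
  linarith

lemma TipAg.limsupF {d e s f c1 c2 : ℝ} {isD : ℕ → Prop} {a b u v ν : ℕ → ℝ}
    (H : TipAg d e s f c1 c2 isD a b u v ν) :
    0 ≤ tipF d e s f c1 c2 (limsup (fun k => a k / (a k + b k)) atTop) (limsup ν atTop) := by
  have hmu := tip_mu_mem H.ha H.hb
  set U := Filter.limsup (fun k => a k / (a k + b k)) atTop with hU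
  set V := Filter.limsup ν atTop with hV
  have hUm := tip_limsup_mem hmu
  have hVm := tip_limsup_mem H.hν
  rw [← hU] at hUm
  rw [← hV] at hVm
  by_contra hcon
  push Not at hcon
  have hU0 : 0 < U := by
    rcases hUm.1.eq_or_lt with h | h
    · rw [← h] at hcon
      unfold tipF at hcon
      have := mul_pos H.hd H.hs
      have : 0 ≤ e * (c1 * max (V - 0) 0) :=
        mul_nonneg H.he (mul_nonneg H.hc1.le (le_max_right _ _))
      linarith
    · exact h
  have hcont : Continuous fun x : ℝ => tipF d e s f c1 c2 (U - x) (V + x) := by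
    unfold tipF
    fun_prop
  have hev : ∀ᶠ x in nhds (0 : ℝ), tipF d e s f c1 c2 (U - x) (V + x) < 0 :=
    hcont.continuousAt.eventually_lt_const (by simpa using hcon)
  have hev2 : ∀ᶠ x in nhds (0 : ℝ), x < U := gt_mem_nhds hU0
  obtain ⟨x, ⟨hx1, hx2⟩, hx0⟩ :=
    (((hev.and hev2).filter_mono nhdsWithin_le_nhds).and
      (self_mem_nhdsWithin (s := Set.Ioi (0 : ℝ)))).exists
  have hx0 : 0 < x := hx0
  have := H.upper (q := U - x) (w := V + x) (by linarith) (by linarith)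
    ((tip_limsup_lt H.hν (by rw [← hV]; linarith)).mono fun _ h => h.le) hx1.le (x / 2) (by linarith)
  have := tip_limsup_le hmu this
  rw [← hU] at this
  linarith

lemma TipAg.liminfF {d e s f c1 c2 : ℝ} {isD : ℕ → Prop} {a b u v ν : ℕ → ℝ}
    (H : TipAg d e s f c1 c2 isD a b u v ν) :
    tipF d e s f c1 c2 (1 - limsup (fun k => 1 - a k / (a k + b k)) atTop)
      (1 - limsup (fun k => 1 - ν k) atTop) ≤ 0 := by
  have h := H.swap.limsupF
  have h1 : ∀ i, b i / (b i + a i) = 1 - a i / (a i + b i) := by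
    intro i
    have := H.ha i
    have := H.hb i
    field_simp
    ring
  simp only [h1] at h
  have h2 := tipF_swap d e s f c1 c2 (1 - Filter.limsup (fun k => 1 - a k / (a k + b k)) atTop)
      (1 - Filter.limsup (fun k => 1 - ν k) atTop)
  rw [sub_sub_cancel, sub_sub_cancel] at h2
  linarith

/-- Comparison between two realizations. -/
lemma tip_two {d e s f c1 c2 d' e' s' f' c1' c2' : ℝ} {isD isD' : ℕ → Prop}
    {a b u v a' b' u' v' A B X Y A' B' X' Y' : ℕ → ℝ}
    (H : TipAg d e s f c1 c2 isD a b u v (fun k => a' k / (a' k + b' k)))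
    (H' : TipAg d' e' s' f' c1' c2' isD' a' b' u' v' (fun k => a k / (a k + b k)))
    (G : TipAg d e s f c1 c2 isD A B X Y (fun k => A' k / (A' k + B' k)))
    (G' : TipAg d' e' s' f' c1' c2' isD' A' B' X' Y' (fun k => A k / (A k + B k))) :
    limsup (fun k => a k / (a k + b k)) atTop ≤ 1 - limsup (fun k => 1 - A k / (A k + B k)) atTop ∧
    limsup (fun k => a' k / (a' k + b' k)) atTop
      ≤ 1 - limsup (fun k => 1 - A' k / (A' k + B' k)) atTop := by
  have h1 := H.limsupF
  have h2 := H'.limsupF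
  have h3 := G.liminfF
  have h4 := G'.liminfF
  have m1 := tip_limsup_mem (tip_mu_mem H.ha H.hb)
  have m2 := tip_limsup_mem (tip_mu_mem H'.ha H'.hb)
  have m3 : (0 : ℝ) ≤ 1 - limsup (fun k => 1 - A k / (A k + B k)) atTop := by
    have := (tip_limsup_mem (x := fun k => 1 - A k / (A k + B k)) fun k => by
      have := tip_mu_mem G.ha G.hb k
      constructor <;> linarith).2
    linarith
  have m4 : (0 : ℝ) ≤ 1 - limsup (fun k => 1 - A' k / (A' k + B' k)) atTop := by
    have := (tip_limsup_mem (x := fun k => 1 - A' k / (A' k + B' k)) fun k => by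
      have := tip_mu_mem G'.ha G'.hb k
      constructor <;> linarith).2
    linarith
  set U := limsup (fun k => a k / (a k + b k)) atTop
  set V := limsup (fun k => a' k / (a' k + b' k)) atTop
  set L := 1 - limsup (fun k => 1 - A k / (A k + B k)) atTop
  set K := 1 - limsup (fun k => 1 - A' k / (A' k + B' k)) atTop
  rcases le_total (V - K) (U - L) with h | h
  · have := tip_cmp H.hd H.he H.hs H.hf H.hc1 H.hc2 m1.2 m3 h1 h3 h
    exact ⟨this, by linarith⟩
  · have := tip_cmp H'.hd H'.he H'.hs H'.hf H'.hc1 H'.hc2 m2.2 m4 h2 h4 h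
    exact ⟨by linarith, this⟩

lemma tip_tendsto_of_limsup {x : ℕ → ℝ} (h : ∀ k, 0 ≤ x k ∧ x k ≤ 1) {t : ℝ}
    (h1 : limsup x atTop ≤ t) (h2 : t ≤ 1 - limsup (fun k => 1 - x k) atTop) :
    Tendsto x atTop (nhds t) := by
  have h' : ∀ k, 0 ≤ 1 - x k ∧ 1 - x k ≤ 1 := fun k => by
    have := h k
    constructor <;> linarith
  rw [tendsto_order]
  constructor
  · intro c hc
    filter_upwards [tip_limsup_lt h' (c := 1 - c) (by linarith)] with k hk
    linarith
  · intro c hc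
    exact tip_limsup_lt h (by linarith)

lemma tip_liminf_le {x : ℕ → ℝ} (h : ∀ k, 0 ≤ x k ∧ x k ≤ 1) :
    1 - limsup (fun k => 1 - x k) atTop ≤ limsup x atTop := by
  have h' : ∀ k, 0 ≤ 1 - x k ∧ 1 - x k ≤ 1 := fun k => by
    have := h k
    constructor <;> linarith
  by_contra hcon
  push Not at hcon
  set L := limsup (fun k => 1 - x k) atTop with hL
  set U := limsup x atTop with hU
  obtain ⟨k, hk1, hk2⟩ := ((tip_limsup_lt h (c := (U + (1 - L)) / 2) (by linarith)).and
    (tip_limsup_lt h' (c := 1 - (U + (1 - L)) / 2) (by linarith))).exists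
  linarith

lemma tip_sqrt_summable : Summable fun k : ℕ => 1 / (((k : ℝ) + 1) * √((k : ℝ) + 1)) := by
  have h := (summable_nat_add_iff 1).2 (Real.summable_one_div_nat_rpow.2 (by norm_num : (1 : ℝ) < 3 / 2))
  refine h.congr fun k => ?_
  push_cast
  have hk : (0 : ℝ) < (k : ℝ) + 1 := by positivity
  rw [show (3 / 2 : ℝ) = 1 + 1 / 2 by norm_num, Real.rpow_add hk, Real.rpow_one, Real.sqrt_eq_rpow]

lemma tip_cs {x p : ℝ} (hp : 0 < p) :
    |x| / p ≤ 1 / 2 * (1 / (p * √p)) + 1 / 2 * (1 / √p) * x ^ 2 := by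
  have hz : 0 < √p := Real.sqrt_pos.2 hp
  have hzz : √p * √p = p := Real.mul_self_sqrt hp.le
  rw [← sq_abs x]
  set y := |x|
  set z := √p
  rw [← hzz]
  have : 1 / 2 * (1 / (z * z * z)) + 1 / 2 * (1 / z) * y ^ 2 - y / (z * z)
      = (1 - y * z) ^ 2 / (2 * (z * z * z)) := by
    field_simp
    ring
  have h2 : 0 ≤ (1 - y * z) ^ 2 / (2 * (z * z * z)) := by positivity
  linarith

lemma tip_noise {mΩ : MeasurableSpace Ω} {P : Measure Ω} [IsProbabilityMeasure P]
    {G : ℕ → MeasurableSpace Ω} {T a b : ℕ → Ω → ℝ} {c : ℝ} (hc : 0 < c)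
    (h : ∀ k, 1 ≤ k → TipCB (G k) P (T k) (a k) (b k))
    (hN : ∀ k ω, c * (k + 1) ≤ a k ω + b k ω) :
    ∀ᵐ ω ∂P, Summable fun k : ℕ =>
      |T (k + 1) ω - a (k + 1) ω / (a (k + 1) ω + b (k + 1) ω)| / ((k : ℝ) + 1) := by
  have hb1 : ∀ k : ℕ, ∀ᵐ ω ∂P,
      |T (k + 1) ω - a (k + 1) ω / (a (k + 1) ω + b (k + 1) ω)| ≤ 1 := by
    intro k
    have H := h (k + 1) (by omega)
    filter_upwards [H.supp] with ω hω
    have ha := H.apos ω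
    have hb := H.bpos ω
    have h1 : 0 ≤ a (k + 1) ω / (a (k + 1) ω + b (k + 1) ω) := by positivity
    have h2 : a (k + 1) ω / (a (k + 1) ω + b (k + 1) ω) ≤ 1 := by
      rw [div_le_one (by positivity)]; linarith
    rw [abs_le]
    constructor <;> linarith [hω.1, hω.2]
  have hmeas : ∀ k : ℕ, Measurable fun ω =>
      T (k + 1) ω - a (k + 1) ω / (a (k + 1) ω + b (k + 1) ω) := fun k => by
    have H := h (k + 1) (by omega)
    have m1 := H.am.mono H.le le_rfl
    have m2 := H.bm.mono H.le le_rfl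
    exact H.meas.sub (m1.div (m1.add m2))
  have hi1 : ∀ k : ℕ, Integrable (fun ω =>
      |T (k + 1) ω - a (k + 1) ω / (a (k + 1) ω + b (k + 1) ω)|) P := fun k => by
    refine Integrable.of_bound (C := 1) (hmeas k).abs.aestronglyMeasurable ?_
    filter_upwards [hb1 k] with ω hω
    rwa [Real.norm_eq_abs, abs_abs]
  have hi2 : ∀ k : ℕ, Integrable (fun ω =>
      (T (k + 1) ω - a (k + 1) ω / (a (k + 1) ω + b (k + 1) ω)) ^ 2) P := fun k => by
    refine Integrable.of_bound (C := 1) ((hmeas k).pow_const 2).aestronglyMeasurable ?_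
    filter_upwards [hb1 k] with ω hω
    rw [Real.norm_of_nonneg (sq_nonneg _)]
    rwa [sq_le_one_iff_abs_le_one]
  have hv : ∀ k : ℕ, ∫ ω, (T (k + 1) ω - a (k + 1) ω / (a (k + 1) ω + b (k + 1) ω)) ^ 2 ∂P
      ≤ 1 / (c * (k + 1)) := by
    intro k
    have H := h (k + 1) (by omega)
    have := H.var (fun _ => 1) measurable_const (integrable_const _)
    simp only [one_mul] at this
    rw [this]
    have h3 : ∫ ω, (1 / (c * (k + 1)) : ℝ) ∂P = 1 / (c * (k + 1)) := by simp
    rw [← h3]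
    refine integral_mono_of_nonneg (Eventually.of_forall fun ω => ?_) (integrable_const _)
      (Eventually.of_forall fun ω => ?_)
    · have ha := H.apos ω
      have hb := H.bpos ω
      simp only [Pi.zero_apply]
      positivity
    · refine (tip_var_le (H.apos ω) (H.bpos ω)).trans ?_
      apply one_div_le_one_div_of_le (by positivity)
      refine le_trans ?_ (hN (k + 1) ω)
      push_cast
      apply mul_le_mul_of_nonneg_left _ hc.le
      linarith
  apply tip_as_summable
  · intro k
    refine Eventually.of_forall fun ω => ?_
    simp only [Pi.zero_apply]
    positivity
  · intro k
    exact (hi1 k).div_const _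
  · have hs : Summable fun k : ℕ => (1 / 2 + 1 / (2 * c)) * (1 / (((k : ℝ) + 1) * √((k : ℝ) + 1))) :=
      tip_sqrt_summable.mul_left _
    refine Summable.of_nonneg_of_le (fun k => integral_nonneg fun ω => ?_) (fun k => ?_) hs
    · simp only [Pi.zero_apply]
      positivity
    · have hk : (0 : ℝ) < (k : ℝ) + 1 := by positivity
      have hint : Integrable (fun ω => 1 / 2 * (1 / (((k : ℝ) + 1) * √((k : ℝ) + 1))) +
          1 / 2 * (1 / √((k : ℝ) + 1)) *
          (T (k + 1) ω - a (k + 1) ω / (a (k + 1) ω + b (k + 1) ω)) ^ 2) P :=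
        (integrable_const _).add ((hi2 k).const_mul _)
      have h1 := integral_mono ((hi1 k).div_const ((k : ℝ) + 1)) hint (fun ω => tip_cs hk)
      refine h1.trans ?_
      rw [integral_add (integrable_const _) ((hi2 k).const_mul _),
        integral_const_mul (1 / 2 * (1 / √((k : ℝ) + 1)))]
      have hz : 0 < √((k : ℝ) + 1) := Real.sqrt_pos.2 hk
      have h2 := mul_le_mul_of_nonneg_left (hv k) (by positivity : 0 ≤ 1 / 2 * (1 / √((k : ℝ) + 1)))
      simp only [integral_const, probReal_univ, one_smul]
      refine (add_le_add_right h2 _).trans (le_of_eq ?_)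
      field_simp

lemma tip_cesaro {N x y : ℕ → ℝ} {c : ℝ} (hc : 0 < c) (hN : ∀ k : ℕ, c * (k + 1) ≤ N k)
    (hx : Summable fun k : ℕ => |x (k + 1)| / ((k : ℝ) + 1))
    (hy : Summable fun k : ℕ => |y (k + 1)| / ((k : ℝ) + 1)) :
    Tendsto (fun k => (∑ i ∈ Finset.range k, (|x i| + |y (i + 1)|)) / N k) atTop (nhds 0) := by
  have hx' : Summable fun k : ℕ => |x k| / ((k : ℝ) + 1) := by
    rw [← summable_nat_add_iff 1]
    refine Summable.of_nonneg_of_le (fun k => by positivity) (fun k => ?_) hx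
    push_cast
    exact div_le_div_of_nonneg_left (abs_nonneg _) (by positivity) (by linarith)
  have hs : Summable fun k : ℕ => (|x k| + |y (k + 1)|) / ((k : ℝ) + 1) := by
    simp_rw [add_div]
    exact hx'.add hy
  have h1 := tip_kron (N := fun k : ℕ => (k : ℝ) + 1) (fun i => by positivity) (fun i => by positivity)
    (fun i j hij => by simpa using hij)
    (tendsto_natCast_atTop_atTop.atTop_add tendsto_const_nhds) hs
  have h2 := h1.const_mul (1 / c)
  rw [mul_zero] at h2
  have hk : ∀ k : ℕ, (0 : ℝ) < (k : ℝ) + 1 := fun k => by positivity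
  refine squeeze_zero (fun k => ?_) (fun k => ?_) h2
  · have : 0 ≤ N k := le_trans (mul_pos hc (hk k)).le (hN k)
    positivity
  · rw [← mul_div_assoc, one_div_mul_eq_div, div_div]
    exact div_le_div_of_nonneg_left (by positivity) (mul_pos hc (hk k)) (hN k)

lemma tip_per {m n : ℕ} (hm : 1 ≤ m) (D : ℕ → ℝ) (g h : ℝ)
    (hD1 : ∀ i, i % (m + n) < m → D i = g) (hD2 : ∀ i, ¬ i % (m + n) < m → D i = h)
    (hle : m * g + n * h ≤ 0) : ∃ C0, ∀ j k, j ≤ k →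
      ∑ i ∈ Finset.range k, D i - ∑ i ∈ Finset.range j, D i ≤ C0 := by
  set M := m + n
  have hM : 0 < M := by omega
  set S : ℕ → ℝ := fun k => ∑ i ∈ Finset.range k, D i with hS
  have hper : ∀ i, D (i + M) = D i := by
    intro i
    by_cases hi : i % M < m
    · rw [hD1 i hi, hD1 _ (by rwa [Nat.add_mod_right])]
    · rw [hD2 i hi, hD2 _ (by rwa [Nat.add_mod_right])]
  have hSM : S M = m * g + n * h := by
    simp only [hS, M]
    rw [Finset.sum_range_add]
    congr 1
    · rw [Finset.sum_congr rfl (g := fun _ => g)]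
      · simp
      · intro i hi
        rw [Finset.mem_range] at hi
        exact hD1 i (by rw [Nat.mod_eq_of_lt (by omega)]; exact hi)
    · rw [Finset.sum_congr rfl (g := fun _ => h)]
      · simp
      · intro i hi
        rw [Finset.mem_range] at hi
        exact hD2 _ (by rw [Nat.mod_eq_of_lt (by omega)]; omega)
  have hadd : ∀ k, S (k + M) = S k + S M := by
    intro k
    induction k with
    | zero => simp [hS]
    | succ k ih =>
      have e1 : S (k + 1 + M) = S (k + M) + D (k + M) := by
        simp only [hS]
        rw [show k + 1 + M = k + M + 1 by ring, Finset.sum_range_succ]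
      have e2 : S (k + 1) = S k + D k := by
        simp only [hS]
        rw [Finset.sum_range_succ]
      rw [e1, ih, hper, e2]; ring
  have hmul : ∀ l k, S (k + M * l) = S k + l * S M := by
    intro l k
    induction l with
    | zero => simp
    | succ l ih =>
      rw [show k + M * (l + 1) = k + M * l + M by ring, hadd, ih]
      push_cast
      ring
  have hbd : ∀ k, |S k| ≤ k * (|g| + |h|) := by
    intro k
    refine (Finset.abs_sum_le_sum_abs _ _).trans ?_
    refine (Finset.sum_le_card_nsmul _ _ (|g| + |h|) ?_).trans
      (le_of_eq (by rw [Finset.card_range, nsmul_eq_mul]))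
    intro i _
    by_cases hi : i % M < m
    · rw [hD1 i hi]; linarith [abs_nonneg h]
    · rw [hD2 i hi]; linarith [abs_nonneg g]
  have hbd2 : ∀ k, |S (k % M)| ≤ M * (|g| + |h|) := fun k =>
    (hbd _).trans (mul_le_mul_of_nonneg_right (by exact_mod_cast (Nat.mod_lt k hM).le)
      (by positivity))
  refine ⟨2 * (M * (|g| + |h|)), fun j k hjk => ?_⟩
  change S k - S j ≤ _
  have hk := hmul (k / M) (k % M)
  have hj := hmul (j / M) (j % M)
  rw [Nat.mod_add_div] at hk hj
  rw [hk, hj]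
  have h1 := (abs_le.1 (hbd2 k)).2
  have h2 := (abs_le.1 (hbd2 j)).1
  have h3 : ((j / M : ℕ) : ℝ) ≤ ((k / M : ℕ) : ℝ) := by exact_mod_cast Nat.div_le_div_right hjk
  have h4 : S M ≤ 0 := hSM ▸ hle
  nlinarith

lemma tip_grow {N : ℕ → ℝ} {M i0 : ℕ} {σ N0 : ℝ} (hσ : 0 < σ) (hN0 : 0 < N0)
    (hi0 : i0 < M) (hmono : Monotone N) (h0 : N0 ≤ N 0)
    (hstep : ∀ j, N (j * M + i0) + σ ≤ N (j * M + i0 + 1)) (k : ℕ) :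
    min N0 σ / M * (k + 1) ≤ N k := by
  have hM : 0 < M := by omega
  have hM' : (0 : ℝ) < M := by exact_mod_cast hM
  have h1 : ∀ j : ℕ, N0 + σ * j ≤ N (j * M) := by
    intro j
    induction j with
    | zero => simpa using h0
    | succ j ih =>
      have a1 := hmono (show j * M ≤ j * M + i0 by omega)
      have a2 := hmono (show j * M + i0 + 1 ≤ (j + 1) * M by rw [add_mul]; omega)
      have := hstep j
      push_cast
      linarith
  have h2 := h1 (k / M)
  have h3 := hmono (Nat.div_mul_le_self k M)
  have h4 : ((k : ℝ) + 1) ≤ M * ((k / M : ℕ) + 1) := by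
    have := Nat.lt_mul_div_succ k hM
    exact_mod_cast this
  have hc : 0 < min N0 σ := lt_min hN0 hσ
  have h5 : min N0 σ / M * (k + 1) ≤ min N0 σ * ((k / M : ℕ) + 1) := by
    rw [div_mul_eq_mul_div, div_le_iff₀ hM', mul_assoc]
    apply mul_le_mul_of_nonneg_left _ hc.le
    linarith
  have h6 : min N0 σ * ((k / M : ℕ) : ℝ) ≤ σ * ((k / M : ℕ) : ℝ) :=
    mul_le_mul_of_nonneg_right (min_le_right _ _) (Nat.cast_nonneg _)
  have h7 := min_le_left N0 σ
  linarith

lemma tip_agent {mΩ : MeasurableSpace Ω} {P : Measure Ω} [IsProbabilityMeasure P]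
    {G G' : ℕ → MeasurableSpace Ω} {T a b T' a' b' : ℕ → Ω → ℝ}
    {d e s f c1 c2 c c' : ℝ} {isD : ℕ → Prop}
    (hd : 0 < d) (he : 0 ≤ e) (hs : 0 < s) (hf : 0 < f) (hc1 : 0 < c1) (hc2 : 0 < c2)
    (h : ∀ k, 1 ≤ k → TipCB (G k) P (T k) (a k) (b k))
    (h' : ∀ k, 1 ≤ k → TipCB (G' k) P (T' k) (a' k) (b' k))
    (ha : ∀ k ω, 0 < a k ω) (hb : ∀ k ω, 0 < b k ω)
    (ha' : ∀ k ω, 0 < a' k ω) (hb' : ∀ k ω, 0 < b' k ω)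
    (dir : ∀ k ω, isD k → a (k + 1) ω = a k ω + s ∧ b (k + 1) ω = b k ω + f)
    (ind : ∀ k ω, ¬ isD k → a (k + 1) ω = a k ω + c1 * max (T' (k + 1) ω - T k ω) 0 ∧
      b (k + 1) ω = b k ω + c2 * max (T k ω - T' (k + 1) ω) 0)
    (hc : 0 < c) (hc' : 0 < c')
    (hN : ∀ k ω, c * (k + 1) ≤ a k ω + b k ω)
    (hN' : ∀ k ω, c' * (k + 1) ≤ a' k ω + b' k ω)
    (per : ∀ (D : ℕ → ℝ) (g h : ℝ), (∀ i, isD i → D i = g) → (∀ i, ¬ isD i → D i = h) →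
      d * g + e * h ≤ 0 → ∃ C0, ∀ j k, j ≤ k →
        ∑ i ∈ Finset.range k, D i - ∑ i ∈ Finset.range j, D i ≤ C0) :
    ∀ᵐ ω ∂P, TipAg d e s f c1 c2 isD (fun k => a k ω) (fun k => b k ω) (fun k => T k ω)
      (fun k => T' k ω) (fun k => a' k ω / (a' k ω + b' k ω)) := by
  have n1 := tip_noise hc h hN
  have n2 := tip_noise hc' h' hN'
  have s1 : ∀ᵐ ω ∂P, ∀ k, 1 ≤ k → 0 < T k ω ∧ T k ω < 1 := by
    rw [ae_all_iff]; intro k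
    rw [Filter.eventually_imp_distrib_left]
    exact fun hk => (h k hk).supp
  have s2 : ∀ᵐ ω ∂P, ∀ k, 1 ≤ k → 0 < T' k ω ∧ T' k ω < 1 := by
    rw [ae_all_iff]; intro k
    rw [Filter.eventually_imp_distrib_left]
    exact fun hk => (h' k hk).supp
  filter_upwards [n1, n2, s1, s2] with ω n1 n2 s1 s2
  exact
  { hd := hd, he := he, hs := hs, hf := hf, hc1 := hc1, hc2 := hc2
    ha := fun k => ha k ω
    hb := fun k => hb k ω
    dir := fun k => dir k ω
    ind := fun k => ind k ω
    hu := fun k hk => ⟨(s1 k hk).1.le, (s1 k hk).2.le⟩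
    hv := fun k hk => ⟨(s2 k hk).1.le, (s2 k hk).2.le⟩
    hν := tip_mu_mem (fun k => ha' k ω) (fun k => hb' k ω)
    lim := tendsto_atTop_mono (fun k => hN k ω)
      ((tendsto_natCast_atTop_atTop.atTop_add tendsto_const_nhds).const_mul_atTop hc)
    noise := tip_cesaro hc (fun k => hN k ω) (x := fun k => T k ω - a k ω / (a k ω + b k ω))
      (y := fun k => T' k ω - a' k ω / (a' k ω + b' k ω)) n1 n2
    per := per }

lemma tip_case_pos {mΩ : MeasurableSpace Ω} {P : Measure Ω} [IsProbabilityMeasure P]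
    {G G' : ℕ → MeasurableSpace Ω} {T a b T' a' b' : ℕ → Ω → ℝ} {m n : ℕ} (hm : 1 ≤ m) (hn : 1 ≤ n)
    {s f c1 c2 s' f' c1' c2' a0 b0 a0' b0' : ℝ}
    (hs : 0 < s) (hf : 0 < f) (hc1 : 0 < c1) (hc2 : 0 < c2)
    (hs' : 0 < s') (hf' : 0 < f') (hc1' : 0 < c1') (hc2' : 0 < c2')
    (ha0 : 0 < a0) (hb0 : 0 < b0) (ha0' : 0 < a0') (hb0' : 0 < b0')
    (h : ∀ k, 1 ≤ k → TipCB (G k) P (T k) (a k) (b k))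
    (h' : ∀ k, 1 ≤ k → TipCB (G' k) P (T' k) (a' k) (b' k))
    (ha : ∀ k ω, a0 ≤ a k ω) (hb : ∀ k ω, b0 ≤ b k ω)
    (ha' : ∀ k ω, a0' ≤ a' k ω) (hb' : ∀ k ω, b0' ≤ b' k ω)
    (dir : ∀ k ω, k % (m + n) < m → a (k + 1) ω = a k ω + s ∧ b (k + 1) ω = b k ω + f)
    (ind : ∀ k ω, ¬ k % (m + n) < m → a (k + 1) ω = a k ω + c1 * max (T' (k + 1) ω - T k ω) 0 ∧
      b (k + 1) ω = b k ω + c2 * max (T k ω - T' (k + 1) ω) 0)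
    (dir' : ∀ k ω, ¬ k % (m + n) < m → a' (k + 1) ω = a' k ω + s' ∧ b' (k + 1) ω = b' k ω + f')
    (ind' : ∀ k ω, k % (m + n) < m →
      a' (k + 1) ω = a' k ω + c1' * max (T (k + 1) ω - T' k ω) 0 ∧
      b' (k + 1) ω = b' k ω + c2' * max (T' k ω - T (k + 1) ω) 0) :
    ∃ tx ty : ℝ, tx ∈ Set.Icc (0 : ℝ) 1 ∧ ty ∈ Set.Icc (0 : ℝ) 1 ∧
      ∀ ε > 0,
        Tendsto (fun k => P {ω | ε < |T k ω - tx|}) atTop (nhds 0) ∧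
        Tendsto (fun k => P {ω | ε < |T' k ω - ty|}) atTop (nhds 0) := by
  have hM : (0 : ℝ) < (m + n : ℕ) := by exact_mod_cast (by omega : 0 < m + n)
  have hmR : (0 : ℝ) < m := by exact_mod_cast hm
  have hnR : (0 : ℝ) < n := by exact_mod_cast hn
  have pos : ∀ k ω, 0 < a k ω := fun k ω => ha0.trans_le (ha k ω)
  have posb : ∀ k ω, 0 < b k ω := fun k ω => hb0.trans_le (hb k ω)
  have pos' : ∀ k ω, 0 < a' k ω := fun k ω => ha0'.trans_le (ha' k ω)
  have posb' : ∀ k ω, 0 < b' k ω := fun k ω => hb0'.trans_le (hb' k ω)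
  have hN : ∀ k ω, min (a0 + b0) (s + f) / (m + n : ℕ) * (k + 1) ≤ a k ω + b k ω := by
    intro k ω
    refine tip_grow (N := fun k => a k ω + b k ω) (i0 := 0) (by positivity) (by positivity)
      (by omega) (monotone_nat_of_le_succ fun i => ?_) (add_le_add (ha 0 ω) (hb 0 ω))
      (fun j => ?_) k
    · by_cases hi : i % (m + n) < m
      · have := dir i ω hi
        linarith
      · have := ind i ω hi
        have := mul_nonneg hc1.le (le_max_right (T' (i + 1) ω - T i ω) 0)
        have := mul_nonneg hc2.le (le_max_right (T i ω - T' (i + 1) ω) 0)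
        linarith
    · have := dir (j * (m + n) + 0) ω (by
        rw [add_zero, Nat.mul_mod_left]; omega)
      linarith
  have hN' : ∀ k ω, min (a0' + b0') (s' + f') / (m + n : ℕ) * (k + 1) ≤ a' k ω + b' k ω := by
    intro k ω
    refine tip_grow (N := fun k => a' k ω + b' k ω) (i0 := m) (by positivity) (by positivity)
      (by omega) (monotone_nat_of_le_succ fun i => ?_) (add_le_add (ha' 0 ω) (hb' 0 ω))
      (fun j => ?_) k
    · by_cases hi : i % (m + n) < m
      · have := ind' i ω hi
        have := mul_nonneg hc1'.le (le_max_right (T (i + 1) ω - T' i ω) 0)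
        have := mul_nonneg hc2'.le (le_max_right (T' i ω - T (i + 1) ω) 0)
        linarith
      · have := dir' i ω hi
        linarith
    · have := dir' (j * (m + n) + m) ω (by
        rw [Nat.mul_add_mod_of_lt (by omega)]; omega)
      linarith
  have hcpos : 0 < min (a0 + b0) (s + f) / (m + n : ℕ) := div_pos (lt_min (by positivity) (by positivity)) hM
  have hcpos' : 0 < min (a0' + b0') (s' + f') / (m + n : ℕ) := div_pos (lt_min (by positivity) (by positivity)) hM
  have A1 := tip_agent (isD := fun k => k % (m + n) < m) hmR hnR.le hs hf hc1 hc2 h h' pos posb pos' posb'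
    dir ind hcpos hcpos' hN hN' (fun D g h => tip_per hm D g h)
  have A2 := tip_agent (isD := fun k => ¬ k % (m + n) < m) hnR hmR.le hs' hf' hc1' hc2' h' h pos' posb'
    pos posb dir' (fun k ω hk => ind' k ω (not_not.1 hk)) hcpos' hcpos hN' hN
    (fun D g h h1 h2 h3 => tip_per hm D h g (fun i hi => h2 i (not_not.2 hi)) h1 (by linarith))
  obtain ⟨ω0, H0, H0'⟩ := (A1.and A2).exists
  have mem := fun ω => tip_mu_mem (fun k => pos k ω) (fun k => posb k ω)
  have mem' := fun ω => tip_mu_mem (fun k => pos' k ω) (fun k => posb' k ω)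
  have conv : ∀ᵐ ω ∂P,
      Tendsto (fun k => a k ω / (a k ω + b k ω)) atTop
        (nhds (limsup (fun k => a k ω0 / (a k ω0 + b k ω0)) atTop)) ∧
      Tendsto (fun k => a' k ω / (a' k ω + b' k ω)) atTop
        (nhds (limsup (fun k => a' k ω0 / (a' k ω0 + b' k ω0)) atTop)) := by
    filter_upwards [A1, A2] with ω H H'
    obtain ⟨p1, p2⟩ := tip_two H H' H0 H0'
    obtain ⟨p3, p4⟩ := tip_two H0 H0' H H'
    exact ⟨tip_tendsto_of_limsup (mem ω) (p1.trans (tip_liminf_le (mem ω0))) p3,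
      tip_tendsto_of_limsup (mem' ω) (p2.trans (tip_liminf_le (mem' ω0))) p4⟩
  refine ⟨_, _, tip_limsup_mem (mem ω0), tip_limsup_mem (mem' ω0), fun ε hε => ⟨?_, ?_⟩⟩
  · exact tip_inprob (c := a0 + b0) (by positivity) h (fun k ω _ => add_le_add (ha k ω) (hb k ω))
      (A1.mono fun ω H => H.lim) (conv.mono fun ω H => H.1) ε hε
  · exact tip_inprob (c := a0' + b0') (by positivity) h' (fun k ω _ => add_le_add (ha' k ω) (hb' k ω))
      (A2.mono fun ω H => H.lim) (conv.mono fun ω H => H.2) ε hε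

lemma tip_bddint {mΩ : MeasurableSpace Ω} {P : Measure Ω} [IsProbabilityMeasure P] {f : Ω → ℝ}
    {C : ℝ} (hf : Measurable f) (h : ∀ᵐ ω ∂P, |f ω| ≤ C) : Integrable f P :=
  Integrable.of_bound (C := C) hf.aestronglyMeasurable h

lemma TipCB.mu_mem {G mΩ : MeasurableSpace Ω} {P : Measure Ω} {T a b : Ω → ℝ}
    (H : TipCB G P T a b) (ω : Ω) : 0 ≤ a ω / (a ω + b ω) ∧ a ω / (a ω + b ω) ≤ 1 := by
  have ha := H.apos ω
  have hb := H.bpos ω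
  refine ⟨by positivity, ?_⟩
  rw [div_le_one (by positivity)]
  linarith

lemma TipCB.v_mem {G mΩ : MeasurableSpace Ω} {P : Measure Ω} {T a b : Ω → ℝ}
    (H : TipCB G P T a b) (ω : Ω) :
    0 ≤ a ω * b ω / ((a ω + b ω) ^ 2 * (a ω + b ω + 1)) ∧
    a ω * b ω / ((a ω + b ω) ^ 2 * (a ω + b ω + 1)) ≤ 1 := by
  have ha := H.apos ω
  have hb := H.bpos ω
  refine ⟨by positivity, ?_⟩
  rw [div_le_one (by positivity)]
  nlinarith [mul_pos ha hb, sq_nonneg (a ω), sq_nonneg (b ω), mul_pos (mul_pos ha hb) (add_pos ha hb),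
    pow_pos (add_pos ha hb) 3]

lemma TipCB.mum {G mΩ : MeasurableSpace Ω} {P : Measure Ω} {T a b : Ω → ℝ}
    (H : TipCB G P T a b) : Measurable[G] fun ω => a ω / (a ω + b ω) :=
  H.am.div (H.am.add H.bm)

lemma TipCB.vm {G mΩ : MeasurableSpace Ω} {P : Measure Ω} {T a b : Ω → ℝ}
    (H : TipCB G P T a b) :
    Measurable fun ω => a ω * b ω / ((a ω + b ω) ^ 2 * (a ω + b ω + 1)) := by
  have m1 := H.am.mono H.le le_rfl
  have m2 := H.bm.mono H.le le_rfl
  fun_prop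

lemma tip_mul_bd {w x C : ℝ} (hw0 : 0 ≤ w) (hw : w ≤ C) (hx : |x| ≤ 1) : |w * x| ≤ C := by
  rw [abs_mul, abs_of_nonneg hw0]
  calc w * |x| ≤ w * 1 := mul_le_mul_of_nonneg_left hx hw0
    _ ≤ C := by linarith

lemma tip_dif_bd {x y : ℝ} (h1 : 0 ≤ x) (h2 : x ≤ 1) (h3 : 0 ≤ y) (h4 : y ≤ 1) :
    |x - y| ≤ 1 := by
  rw [abs_le]; constructor <;> linarith

lemma tip_sq_bd {x : ℝ} (h : |x| ≤ 1) : |x ^ 2| ≤ 1 := by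
  rw [abs_pow]; exact pow_le_one₀ (abs_nonneg _) h

lemma tip_step1 {F G mΩ : MeasurableSpace Ω} {P : Measure Ω} [IsProbabilityMeasure P]
    {T a b X A B W : Ω → ℝ} {q C : ℝ}
    (hT : TipCB G P T a b) (hX : TipCB F P X A B) (GF : G ≤ F) (Tm : Measurable[F] T)
    (hq : ∀ ω, A ω / (A ω + B ω) = q) (hW : Measurable[G] W) (W0 : ∀ ω, 0 ≤ W ω)
    (WC : ∀ ω, W ω ≤ C) :
    Integrable (fun ω => W ω * ((q - a ω / (a ω + b ω)) ^ 2
      + a ω * b ω / ((a ω + b ω) ^ 2 * (a ω + b ω + 1)))) P ∧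
    Integrable (fun ω => W ω * (X ω - T ω) ^ 2) P ∧
    ∫ ω, W ω * ((q - a ω / (a ω + b ω)) ^ 2
      + a ω * b ω / ((a ω + b ω) ^ 2 * (a ω + b ω + 1))) ∂P ≤ ∫ ω, W ω * (X ω - T ω) ^ 2 ∂P := by
  have hWm : Measurable W := hW.mono hT.le le_rfl
  have hWF : Measurable[F] W := hW.mono GF le_rfl
  have mum : Measurable fun ω => a ω / (a ω + b ω) := hT.mum.mono hT.le le_rfl
  have Tmeas := hT.meas
  have Xmeas := hX.meas
  obtain ⟨ω0, -⟩ : ∃ ω : Ω, True := by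
    by_contra hcon
    have : IsEmpty Ω := ⟨fun ω => hcon ⟨ω, trivial⟩⟩
    have h1 := measure_univ (μ := P)
    rw [Measure.eq_zero_of_isEmpty P] at h1
    simp at h1
  have hq01 := hX.mu_mem ω0
  rw [hq] at hq01
  have i1 : Integrable (fun ω => (W ω * (q - T ω)) * (X ω - q)) P := by
    refine tip_bddint (C := C) (by fun_prop) ?_
    filter_upwards [hT.supp, hX.supp] with ω h1 h2
    rw [mul_assoc]
    refine tip_mul_bd (W0 ω) (WC ω) ?_
    rw [abs_mul]
    exact mul_le_one₀ (tip_dif_bd hq01.1 hq01.2 h1.1.le h1.2.le) (abs_nonneg _)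
      (tip_dif_bd h2.1.le h2.2.le hq01.1 hq01.2)
  have i2 : Integrable (fun ω => (W ω * (q - a ω / (a ω + b ω))) * (T ω - a ω / (a ω + b ω))) P := by
    refine tip_bddint (C := C) (by fun_prop) ?_
    filter_upwards [hT.supp, hX.supp] with ω h1 h2
    have := hT.mu_mem ω
    rw [mul_assoc]
    refine tip_mul_bd (W0 ω) (WC ω) ?_
    rw [abs_mul]
    exact mul_le_one₀ (tip_dif_bd hq01.1 hq01.2 this.1 this.2) (abs_nonneg _)
      (tip_dif_bd h1.1.le h1.2.le this.1 this.2)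
  have i3 : Integrable (fun ω => W ω * (X ω - q) ^ 2) P := by
    refine tip_bddint (C := C) (by fun_prop) ?_
    filter_upwards [hT.supp, hX.supp] with ω h1 h2
    exact tip_mul_bd (W0 ω) (WC ω) (tip_sq_bd (tip_dif_bd h2.1.le h2.2.le hq01.1 hq01.2))
  have i4 : Integrable (fun ω => W ω * (q - a ω / (a ω + b ω)) ^ 2) P := by
    refine tip_bddint (C := C) (by fun_prop) ?_
    refine Eventually.of_forall fun ω => ?_
    have := hT.mu_mem ω
    exact tip_mul_bd (W0 ω) (WC ω) (tip_sq_bd (tip_dif_bd hq01.1 hq01.2 this.1 this.2))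
  have i5 : Integrable (fun ω => W ω * (T ω - a ω / (a ω + b ω)) ^ 2) P := by
    refine tip_bddint (C := C) (by fun_prop) ?_
    filter_upwards [hT.supp, hX.supp] with ω h1 h2
    have := hT.mu_mem ω
    exact tip_mul_bd (W0 ω) (WC ω) (tip_sq_bd (tip_dif_bd h1.1.le h1.2.le this.1 this.2))
  have i6 : Integrable (fun ω => W ω * (a ω * b ω / ((a ω + b ω) ^ 2 * (a ω + b ω + 1)))) P := by
    refine tip_bddint (C := C) (hWm.mul hT.vm) ?_
    refine Eventually.of_forall fun ω => ?_
    have := hT.v_mem ω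
    exact tip_mul_bd (W0 ω) (WC ω) (by rw [abs_of_nonneg this.1]; exact this.2)
  have i7 : Integrable (fun ω => W ω * (X ω - T ω) ^ 2) P := by
    refine tip_bddint (C := C) (by fun_prop) ?_
    filter_upwards [hT.supp, hX.supp] with ω h1 h2
    exact tip_mul_bd (W0 ω) (WC ω) (tip_sq_bd (tip_dif_bd h2.1.le h2.2.le h1.1.le h1.2.le))
  have iW1 : Integrable (fun ω => W ω * (q - T ω)) P := by
    refine tip_bddint (C := C) (by fun_prop) ?_
    filter_upwards [hT.supp] with ω h1
    exact tip_mul_bd (W0 ω) (WC ω) (tip_dif_bd hq01.1 hq01.2 h1.1.le h1.2.le)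
  have iW2 : Integrable (fun ω => W ω * (q - a ω / (a ω + b ω))) P := by
    refine tip_bddint (C := C) (by fun_prop) ?_
    refine Eventually.of_forall fun ω => ?_
    have := hT.mu_mem ω
    exact tip_mul_bd (W0 ω) (WC ω) (tip_dif_bd hq01.1 hq01.2 this.1 this.2)
  have iW : Integrable W P := by
    refine tip_bddint (C := C) hWm (Eventually.of_forall fun ω => ?_)
    rw [abs_of_nonneg (W0 ω)]; exact WC ω
  have m1 := hX.mean (fun ω => W ω * (q - T ω)) (hWF.mul (Tm.const_sub q)) iW1
  have m2 := hT.mean (fun ω => W ω * (q - a ω / (a ω + b ω))) (hW.mul (hT.mum.const_sub q)) iW2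
  have m3 := hT.var W hW iW
  simp only [hq] at m1
  refine ⟨?_, i7, ?_⟩
  · simp only [mul_add (W _)]
    exact i4.add i6
  · have e1 : ∫ ω, W ω * (X ω - T ω) ^ 2 ∂P =
        ∫ ω, W ω * (X ω - q) ^ 2 + (2 * ((W ω * (q - T ω)) * (X ω - q)) +
          (W ω * (q - a ω / (a ω + b ω)) ^ 2 + (W ω * (T ω - a ω / (a ω + b ω)) ^ 2 +
          (-2) * ((W ω * (q - a ω / (a ω + b ω))) * (T ω - a ω / (a ω + b ω)))))) ∂P := by
      congr 1
      ext ω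
      ring
    have j1 := i2.const_mul (-2)
    have j2 : Integrable (fun ω => W ω * (T ω - a ω / (a ω + b ω)) ^ 2 +
          (-2) * ((W ω * (q - a ω / (a ω + b ω))) * (T ω - a ω / (a ω + b ω)))) P := i5.add j1
    have j3 : Integrable (fun ω => W ω * (q - a ω / (a ω + b ω)) ^ 2 + (W ω * (T ω - a ω / (a ω + b ω)) ^ 2 +
          (-2) * ((W ω * (q - a ω / (a ω + b ω))) * (T ω - a ω / (a ω + b ω))))) P := i4.add j2
    have j4 : Integrable (fun ω => 2 * ((W ω * (q - T ω)) * (X ω - q)) +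
          (W ω * (q - a ω / (a ω + b ω)) ^ 2 + (W ω * (T ω - a ω / (a ω + b ω)) ^ 2 +
          (-2) * ((W ω * (q - a ω / (a ω + b ω))) * (T ω - a ω / (a ω + b ω)))))) P :=
      (i1.const_mul 2).add j3
    rw [e1, integral_add i3 j4, integral_add (i1.const_mul 2) j3, integral_add i4 j2,
      integral_add i5 j1, integral_const_mul, integral_const_mul, m1, m2, m3]
    simp only [mul_add (W _)]
    rw [integral_add i4 i6]
    have : 0 ≤ ∫ ω, W ω * (X ω - q) ^ 2 ∂P := integral_nonneg fun ω =>
      mul_nonneg (W0 ω) (sq_nonneg _)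
    linarith

lemma tip_step3 {F G mΩ : MeasurableSpace Ω} {P : Measure Ω} [IsProbabilityMeasure P]
    {T a b X A B W : Ω → ℝ} {q C cx : ℝ} (hcx : 0 < cx)
    (hT : TipCB G P T a b) (hX : TipCB F P X A B) (GF : G ≤ F)
    (hq : ∀ ω, A ω / (A ω + B ω) = q) (hcN : ∀ ω, cx ≤ A ω + B ω)
    (hW : Measurable[G] W) (W0 : ∀ ω, 0 ≤ W ω) (WC : ∀ ω, W ω ≤ C) (hq01 : 0 ≤ q ∧ q ≤ 1) :
    Integrable (fun ω => W ω * ((T ω - a ω / (a ω + b ω)) ^ 2 + (X ω - q) ^ 2)) P ∧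
    ∫ ω, W ω * ((T ω - a ω / (a ω + b ω)) ^ 2 + (X ω - q) ^ 2) ∂P
      ≤ ∫ ω, W ω * (a ω * b ω / ((a ω + b ω) ^ 2 * (a ω + b ω + 1)) + 1 / cx) ∂P := by
  have hWm : Measurable W := hW.mono hT.le le_rfl
  have hWF : Measurable[F] W := hW.mono GF le_rfl
  have mum : Measurable fun ω => a ω / (a ω + b ω) := hT.mum.mono hT.le le_rfl
  have Tmeas := hT.meas
  have Xmeas := hX.meas
  have iW : Integrable W P := by
    refine tip_bddint (C := C) hWm (Eventually.of_forall fun ω => ?_)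
    rw [abs_of_nonneg (W0 ω)]; exact WC ω
  have i3 : Integrable (fun ω => W ω * (X ω - q) ^ 2) P := by
    refine tip_bddint (C := C) (by fun_prop) ?_
    filter_upwards [hT.supp, hX.supp] with ω h1 h2
    exact tip_mul_bd (W0 ω) (WC ω) (tip_sq_bd (tip_dif_bd h2.1.le h2.2.le hq01.1 hq01.2))
  have i5 : Integrable (fun ω => W ω * (T ω - a ω / (a ω + b ω)) ^ 2) P := by
    refine tip_bddint (C := C) (by fun_prop) ?_
    filter_upwards [hT.supp, hX.supp] with ω h1 h2
    have := hT.mu_mem ω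
    exact tip_mul_bd (W0 ω) (WC ω) (tip_sq_bd (tip_dif_bd h1.1.le h1.2.le this.1 this.2))
  have i6 : Integrable (fun ω => W ω * (a ω * b ω / ((a ω + b ω) ^ 2 * (a ω + b ω + 1)))) P := by
    refine tip_bddint (C := C) (hWm.mul hT.vm) ?_
    refine Eventually.of_forall fun ω => ?_
    have := hT.v_mem ω
    exact tip_mul_bd (W0 ω) (WC ω) (by rw [abs_of_nonneg this.1]; exact this.2)
  have m3 := hT.var W hW iW
  have m4 := hX.var W hWF iW
  simp only [hq] at m4
  simp only [mul_add (W _)]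
  refine ⟨i5.add i3, ?_⟩
  rw [integral_add i5 i3, integral_add i6 (iW.mul_const _), m3, m4]
  refine add_le_add le_rfl ?_
  refine integral_mono_of_nonneg (Eventually.of_forall fun ω => ?_) (iW.mul_const _)
    (Eventually.of_forall fun ω => ?_)
  · exact mul_nonneg (W0 ω) (hX.v_mem ω).1
  · refine mul_le_mul_of_nonneg_left ?_ (W0 ω)
    exact (tip_var_le (hX.apos ω) (hX.bpos ω)).trans (one_div_le_one_div_of_le hcx (hcN ω))

lemma tip_tele {c0 c1 c2 N x y : ℝ} (hc0 : 0 < c0) (hc1 : 0 < c1) (hc2 : 0 < c2) (hN : c0 ≤ N)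
    (hx : |x - y| ≤ 1) :
    (N ^ 2)⁻¹ * (x - y) ^ 2 ≤ (1 + (c1 + c2) / c0) / min c1 c2 *
      (1 / N - 1 / (N + (c1 * max (x - y) 0 + c2 * max (y - x) 0))) := by
  have hm : 0 < min c1 c2 := lt_min hc1 hc2
  have hNp : 0 < N := hc0.trans_le hN
  have m1 : max (x - y) 0 ≤ 1 := max_le ((le_abs_self _).trans hx) zero_le_one
  have m2 : max (y - x) 0 ≤ 1 := max_le ((neg_sub x y ▸ neg_le_abs (x - y)).trans hx) zero_le_one
  have m3 : 0 ≤ max (x - y) 0 := le_max_right _ _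
  have m4 : 0 ≤ max (y - x) 0 := le_max_right _ _
  have m5 : |x - y| ≤ max (x - y) 0 + max (y - x) 0 := by
    rw [abs_le']
    constructor
    · linarith [le_max_left (x - y) 0]
    · linarith [le_max_left (y - x) 0]
  set d := c1 * max (x - y) 0 + c2 * max (y - x) 0 with hd
  have d0 : 0 ≤ d := by positivity
  have d1 : d ≤ c1 + c2 := by nlinarith
  have d2 : min c1 c2 * |x - y| ≤ d := by
    have := mul_le_mul_of_nonneg_left m5 hm.le
    have h1 := mul_le_mul_of_nonneg_right (min_le_left c1 c2) m3
    have h2 := mul_le_mul_of_nonneg_right (min_le_right c1 c2) m4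
    linarith
  have d3 : min c1 c2 * (x - y) ^ 2 ≤ d := by
    refine le_trans (mul_le_mul_of_nonneg_left ?_ hm.le) d2
    rw [← sq_abs]
    nlinarith [abs_nonneg (x - y)]
  have hNd : N + d ≤ N * (1 + (c1 + c2) / c0) := by
    have : c1 + c2 ≤ N * ((c1 + c2) / c0) := by
      rw [mul_div_assoc', le_div_iff₀ hc0]
      nlinarith
    linarith
  set κ := 1 + (c1 + c2) / c0 with hκ
  have hκ0 : 0 < κ := by positivity
  have e1 : 1 / N - 1 / (N + d) = d / (N * (N + d)) := by
    field_simp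
    ring
  rw [e1, inv_mul_eq_div, div_mul_div_comm, div_le_div_iff₀ (by positivity) (by positivity)]
  calc (x - y) ^ 2 * (min c1 c2 * (N * (N + d))) = (min c1 c2 * (x - y) ^ 2) * (N * (N + d)) := by ring
    _ ≤ d * (N * (N * κ)) := by gcongr
    _ = κ * d * N ^ 2 := by ring

structure TipY (F G : ℕ → MeasurableSpace Ω) {mΩ : MeasurableSpace Ω} (P : Measure Ω)
    (T a b X A B : ℕ → Ω → ℝ) (q : ℕ → ℝ) (c1 c2 c0 cx p : ℝ) : Prop where
  hT : ∀ j, TipCB (G j) P (T j) (a j) (b j)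
  hX : ∀ j, TipCB (F j) P (X j) (A j) (B j)
  GF : ∀ j, G j ≤ F j
  FG : ∀ j, F j ≤ G (j + 1)
  Tm : ∀ j, Measurable[F j] (T j)
  ea : ∀ j ω, a (j + 1) ω = a j ω + c1 * max (X j ω - T j ω) 0
  eb : ∀ j ω, b (j + 1) ω = b j ω + c2 * max (T j ω - X j ω) 0
  hc1 : 0 < c1
  hc2 : 0 < c2
  hc0 : 0 < c0
  hcx : 0 < cx
  ha : ∀ j ω, c0 ≤ a j ω
  hb : ∀ j ω, c0 ≤ b j ω
  hAN : ∀ j ω, cx * (j + 1) ≤ A j ω + B j ω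
  hq : ∀ j ω, A j ω / (A j ω + B j ω) = q j
  hq01 : ∀ j, 0 ≤ q j ∧ q j ≤ 1
  hp : Tendsto q atTop (nhds p)

section
variable {F G : ℕ → MeasurableSpace Ω} {mΩ : MeasurableSpace Ω} {P : Measure Ω}
    {T a b X A B : ℕ → Ω → ℝ} {q : ℕ → ℝ} {c1 c2 c0 cx p : ℝ}

lemma TipY.swap (H : TipY F G P T a b X A B q c1 c2 c0 cx p) :
    TipY F G P (fun j ω => 1 - T j ω) b a (fun j ω => 1 - X j ω) B A (fun j => 1 - q j)
      c2 c1 c0 cx (1 - p) where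
  hT j := (H.hT j).swap
  hX j := (H.hX j).swap
  GF := H.GF
  FG := H.FG
  Tm j := (H.Tm j).const_sub 1
  ea j ω := by rw [H.eb]; congr 3; ring
  eb j ω := by rw [H.ea]; congr 3; ring
  hc1 := H.hc2
  hc2 := H.hc1
  hc0 := H.hc0
  hcx := H.hcx
  ha := H.hb
  hb := H.ha
  hAN j ω := by rw [add_comm (B j ω)]; exact H.hAN j ω
  hq j ω := by
    rw [← H.hq j ω]
    have := (H.hX j).apos ω
    have := (H.hX j).bpos ω
    field_simp
    ring
  hq01 j := by have := H.hq01 j; constructor <;> linarith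
  hp := H.hp.const_sub 1

lemma TipY.N0 (H : TipY F G P T a b X A B q c1 c2 c0 cx p) (j : ℕ) (ω : Ω) :
    c0 ≤ a j ω + b j ω := by
  linarith [H.ha j ω, H.hb j ω, H.hc0]

lemma TipY.mono (H : TipY F G P T a b X A B q c1 c2 c0 cx p) (ω : Ω) :
    Monotone fun j => a j ω + b j ω := by
  refine monotone_nat_of_le_succ fun j => ?_
  rw [H.ea, H.eb]
  have := mul_nonneg H.hc1.le (le_max_right (X j ω - T j ω) 0)
  have := mul_nonneg H.hc2.le (le_max_right (T j ω - X j ω) 0)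
  linarith

lemma TipY.supp (H : TipY F G P T a b X A B q c1 c2 c0 cx p) :
    ∀ᵐ ω ∂P, ∀ j, (0 < T j ω ∧ T j ω < 1) ∧ (0 < X j ω ∧ X j ω < 1) := by
  rw [ae_all_iff]
  exact fun j => (H.hT j).supp.and (H.hX j).supp

/-- the summable function -/
noncomputable def tipg (a b : ℕ → Ω → ℝ) (q : ℕ → ℝ) (j : ℕ) (ω : Ω) : ℝ :=
  ((a j ω + b j ω) ^ 2)⁻¹ * ((q j - a j ω / (a j ω + b j ω)) ^ 2
      + a j ω * b j ω / ((a j ω + b j ω) ^ 2 * (a j ω + b j ω + 1)))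

lemma TipY.g0 (H : TipY F G P T a b X A B q c1 c2 c0 cx p) (j : ℕ) (ω : Ω) :
    0 ≤ tipg a b q j ω := by
  have := (H.hT j).apos ω
  have := (H.hT j).bpos ω
  unfold tipg
  positivity

lemma TipY.key [IsProbabilityMeasure P] (H : TipY F G P T a b X A B q c1 c2 c0 cx p) :
    (∀ j, Integrable (tipg a b q j) P) ∧ Summable fun j => ∫ ω, tipg a b q j ω ∂P := by
  have hstep := fun j => tip_step1 (W := fun ω => ((a j ω + b j ω) ^ 2)⁻¹) (C := (c0 ^ 2)⁻¹)
    (H.hT j) (H.hX j) (H.GF j) (H.Tm j) (H.hq j)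
    ((((H.hT j).am.add (H.hT j).bm).pow_const 2).inv)
    (fun ω => by positivity) (fun ω => by
      have := H.N0 j ω
      have := H.hc0
      gcongr)
  refine ⟨fun j => (hstep j).1, ?_⟩
  have hNi : ∀ j, Integrable (fun ω => 1 / (a j ω + b j ω)) P := fun j => by
    refine tip_bddint (C := 1 / c0) ?_ (Eventually.of_forall fun ω => ?_)
    · have m1 := (H.hT j).am.mono (H.hT j).le le_rfl
      have m2 := (H.hT j).bm.mono (H.hT j).le le_rfl
      fun_prop
    · have := H.N0 j ω
      have h0 := H.hc0
      rw [abs_of_nonneg (by have := h0.trans_le this; positivity)]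
      exact one_div_le_one_div_of_le h0 this
  set κ := (1 + (c1 + c2) / c0) / min c1 c2 with hκ
  have hκ0 : 0 ≤ κ := by
    have := H.hc1
    have := H.hc2
    have := H.hc0
    positivity
  have hle : ∀ j, ∫ ω, tipg a b q j ω ∂P ≤ κ * (∫ ω, 1 / (a j ω + b j ω) ∂P -
      ∫ ω, 1 / (a (j + 1) ω + b (j + 1) ω) ∂P) := by
    intro j
    refine (hstep j).2.2.trans ?_
    rw [← integral_sub (hNi j) (hNi (j + 1)), ← integral_const_mul]
    refine integral_mono_ae (hstep j).2.1 (((hNi j).sub (hNi (j + 1))).const_mul κ) ?_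
    filter_upwards [H.supp] with ω hω
    have := tip_tele (x := X j ω) (y := T j ω) H.hc0 H.hc1 H.hc2 (H.N0 j ω)
      (tip_dif_bd (hω j).2.1.le (hω j).2.2.le (hω j).1.1.le (hω j).1.2.le)
    rw [H.ea, H.eb]
    refine this.trans (le_of_eq ?_)
    rw [hκ]
    congr 3
    ring
  refine summable_of_sum_range_le (c := κ * ∫ ω, 1 / (a 0 ω + b 0 ω) ∂P)
    (fun j => integral_nonneg (H.g0 j)) (fun n => ?_)
  refine (Finset.sum_le_sum fun j _ => hle j).trans ?_
  rw [← Finset.mul_sum, Finset.sum_range_sub']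
  apply mul_le_mul_of_nonneg_left _ hκ0
  have : 0 ≤ ∫ ω, 1 / (a n ω + b n ω) ∂P := integral_nonneg fun ω => by
    have := (H.hT n).apos ω
    have := (H.hT n).bpos ω
    simp only [Pi.zero_apply]
    positivity
  linarith

lemma TipY.Nlim [IsProbabilityMeasure P] (H : TipY F G P T a b X A B q c1 c2 c0 cx p) :
    ∀ᵐ ω ∂P, Tendsto (fun j => a j ω + b j ω) atTop atTop := by
  have h := tip_as_summable (fun j => Eventually.of_forall (H.g0 j)) H.key.1 H.key.2
  filter_upwards [h] with ω hω
  rcases tendsto_atTop_of_monotone (H.mono ω) with h1 | ⟨l, hl⟩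
  · exact h1
  · exfalso
    have hle : ∀ j, a j ω + b j ω ≤ l := fun j => (H.mono ω).ge_of_tendsto hl j
    have hc0 := H.hc0
    have hl0 : 0 < l := hc0.trans_le ((H.N0 0 ω).trans (hle 0))
    have hlow : ∀ j, (l ^ 2)⁻¹ * (c0 * c0 / (l ^ 2 * (l + 1))) ≤ tipg a b q j ω := by
      intro j
      have ha := (H.hT j).apos ω
      have hb := (H.hT j).bpos ω
      have h3 := hle j
      have h4 := H.ha j ω
      have h5 := H.hb j ω
      unfold tipg
      apply mul_le_mul
      · gcongr
      · have : c0 * c0 / (l ^ 2 * (l + 1))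
          ≤ a j ω * b j ω / ((a j ω + b j ω) ^ 2 * (a j ω + b j ω + 1)) := by gcongr
        linarith [sq_nonneg (q j - a j ω / (a j ω + b j ω))]
      · positivity
      · positivity
    have h2 := ge_of_tendsto' hω.tendsto_atTop_zero hlow
    have : 0 < (l ^ 2)⁻¹ * (c0 * c0 / (l ^ 2 * (l + 1))) := by positivity
    linarith
end

lemma tip_exc {ε p q μ x t : ℝ} (hε : 0 < ε) (hq : q ≤ p + ε / 2) (hμ : p + ε ≤ μ) :
    max (x - t) 0 ≤ 1 / ε * ((t - μ) ^ 2 + (x - q) ^ 2) := by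
  apply max_le
  · rw [one_div_mul_eq_div, le_div_iff₀ hε]
    nlinarith [sq_nonneg (x - q - ε / 2), sq_nonneg (μ - t - ε / 2)]
  · positivity

section
variable {F G : ℕ → MeasurableSpace Ω} {mΩ : MeasurableSpace Ω} {P : Measure Ω}
    {T a b X A B : ℕ → Ω → ℝ} {q : ℕ → ℝ} {c1 c2 c0 cx p : ℝ}

lemma TipY.Nup (H : TipY F G P T a b X A B q c1 c2 c0 cx p) :
    ∀ᵐ ω ∂P, ∀ j : ℕ, a j ω + b j ω ≤ (a 0 ω + b 0 ω + (c1 + c2)) * (j + 1) := by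
  filter_upwards [H.supp] with ω hω
  have hc1 := H.hc1
  have hc2 := H.hc2
  have h1 : ∀ j : ℕ, a j ω + b j ω ≤ a 0 ω + b 0 ω + (c1 + c2) * j := by
    intro j
    induction j with
    | zero => simp
    | succ j ih =>
      rw [H.ea, H.eb]
      have hd := hω j
      have m1 : max (X j ω - T j ω) 0 ≤ 1 := max_le (by linarith) zero_le_one
      have m2 : max (T j ω - X j ω) 0 ≤ 1 := max_le (by linarith) zero_le_one
      have := mul_le_mul_of_nonneg_left m1 hc1.le
      have := mul_le_mul_of_nonneg_left m2 hc2.le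
      push_cast
      linarith
  intro j
  have h2 := H.N0 0 ω
  have h3 := H.hc0
  have h4 : (0 : ℝ) ≤ j := Nat.cast_nonneg j
  have : 0 ≤ (a 0 ω + b 0 ω) * j := by
    apply mul_nonneg _ h4
    linarith
  linarith [h1 j]

lemma TipY.G0 (H : TipY F G P T a b X A B q c1 c2 c0 cx p) (j : ℕ) : G 0 ≤ G j := by
  induction j with
  | zero => exact le_rfl
  | succ j ih => exact ih.trans ((H.GF j).trans (H.FG j))

set_option maxHeartbeats 1600000 in
lemma TipY.exc [IsProbabilityMeasure P] (H : TipY F G P T a b X A B q c1 c2 c0 cx p)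
    {ε : ℝ} (hε : 0 < ε) :
    ∀ᵐ ω ∂P, Summable fun j => ((if p + ε ≤ a j ω / (a j ω + b j ω) then (1 : ℝ) else 0) *
      (c1 * max (X j ω - T j ω) 0)) / (a j ω + b j ω) := by
  have hc0 := H.hc0
  have hc1 := H.hc1
  have hc2 := H.hc2
  have hcx := H.hcx
  set φ : ℝ → ℝ := fun x => if p + ε ≤ x then (1 : ℝ) else 0 with hφ
  have hφm : Measurable φ := Measurable.ite measurableSet_Ici measurable_const measurable_const
  have φ0 : ∀ x, 0 ≤ φ x := fun x => by simp only [hφ]; split_ifs <;> norm_num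
  have φ1 : ∀ x, φ x ≤ 1 := fun x => by simp only [hφ]; split_ifs <;> norm_num
  set V : ℕ → Ω → ℝ := fun j ω => (a 0 ω + b 0 ω + (c1 + c2))⁻¹ *
    (φ (a j ω / (a j ω + b j ω)) * (a j ω + b j ω)⁻¹) with hV
  have Np : ∀ j ω, 0 < a j ω + b j ω := fun j ω => hc0.trans_le (H.N0 j ω)
  have D0 : ∀ ω, 0 < (a 0 ω + b 0 ω + (c1 + c2))⁻¹ := fun ω => by
    have := Np 0 ω
    positivity
  have D1 : ∀ ω, (a 0 ω + b 0 ω + (c1 + c2))⁻¹ ≤ (c1 + c2)⁻¹ := fun ω => by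
    have := Np 0 ω
    apply inv_anti₀ (by positivity)
    linarith
  have V0 : ∀ j ω, 0 ≤ V j ω := fun j ω =>
    mul_nonneg (D0 ω).le (mul_nonneg (φ0 _) (inv_nonneg.2 (Np j ω).le))
  have V1 : ∀ j ω, V j ω ≤ (c1 + c2)⁻¹ * c0⁻¹ := fun j ω => by
    have h1 : (a j ω + b j ω)⁻¹ ≤ c0⁻¹ := inv_anti₀ hc0 (H.N0 j ω)
    have h2 : φ (a j ω / (a j ω + b j ω)) * (a j ω + b j ω)⁻¹ ≤ c0⁻¹ :=
      (mul_le_of_le_one_left (inv_nonneg.2 (Np j ω).le) (φ1 _)).trans h1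
    exact mul_le_mul (D1 ω) h2 (mul_nonneg (φ0 _) (inv_nonneg.2 (Np j ω).le)) (by positivity)
  have Vm : ∀ j, Measurable[G j] (V j) := fun j => by
    have n0 := ((H.hT 0).am.add (H.hT 0).bm).mono (H.G0 j) le_rfl
    have nj := (H.hT j).am.add (H.hT j).bm
    exact ((n0.add_const (c1 + c2)).inv).mul ((hφm.comp (H.hT j).mum).mul nj.inv)
  obtain ⟨K, hK⟩ := eventually_atTop.1
    (H.hp.eventually (gt_mem_nhds (show p < p + ε / 2 by linarith)))
  have hst := fun j : ℕ => tip_step3 (cx := cx * (j + 1)) (by positivity) (H.hT j) (H.hX j) (H.GF j)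
    (H.hq j) (H.hAN j) (Vm j) (V0 j) (V1 j) (H.hq01 j)
  have hpt : ∀ j ω, K ≤ j → V j ω * max (X j ω - T j ω) 0 ≤
      1 / ε * (V j ω * ((T j ω - a j ω / (a j ω + b j ω)) ^ 2 + (X j ω - q j) ^ 2)) := by
    intro j ω hj
    by_cases h : p + ε ≤ a j ω / (a j ω + b j ω)
    · have := mul_le_mul_of_nonneg_left (tip_exc (x := X j ω) (t := T j ω) hε (hK j hj).le h) (V0 j ω)
      linarith
    · have : V j ω = 0 := by simp [hV, hφ, h]
      rw [this]; simp
  set C3 := ((c1 + c2)⁻¹ + cx⁻¹) * (4 / ε ^ 2) with hC3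
  have hC30 : 0 ≤ C3 := by positivity
  have hg : ∀ j : ℕ, K ≤ j →
      ∫ ω, V j ω * (a j ω * b j ω / ((a j ω + b j ω) ^ 2 * (a j ω + b j ω + 1)) +
        1 / (cx * (j + 1))) ∂P ≤ C3 * ∫ ω, tipg a b q j ω ∂P := by
    intro j hj
    rw [← integral_const_mul]
    refine integral_mono_of_nonneg (Eventually.of_forall fun ω => ?_)
      ((H.key.1 j).const_mul _) ?_
    · exact mul_nonneg (V0 j ω) (add_nonneg ((H.hT j).v_mem ω).1 (by positivity))
    · filter_upwards [H.Nup] with ω hω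
      by_cases h : p + ε ≤ a j ω / (a j ω + b j ω)
      · have hφ1 : φ (a j ω / (a j ω + b j ω)) = 1 := by simp [hφ, h]
        have hv := tip_var_le ((H.hT j).apos ω) ((H.hT j).bpos ω)
        have hgl : ((a j ω + b j ω) ^ 2)⁻¹ * (ε ^ 2 / 4) ≤ tipg a b q j ω := by
          unfold tipg
          apply mul_le_mul_of_nonneg_left _ (by positivity)
          have := ((H.hT j).v_mem ω).1
          have := hK j hj
          nlinarith
        set N := a j ω + b j ω with hN
        have hNp : 0 < N := Np j ω
        set D := (a 0 ω + b 0 ω + (c1 + c2))⁻¹ with hD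
        have hDp : 0 < D := D0 ω
        have hDN : D * (1 / (cx * (j + 1))) ≤ cx⁻¹ * N⁻¹ := by
          have h1 := hω j
          rw [← hN] at h1
          have h2 : D * N ≤ j + 1 := by
            rw [hD, inv_mul_le_iff₀ (by have := Np 0 ω; positivity)]
            exact h1
          rw [mul_one_div, ← mul_inv, div_le_iff₀ (by positivity)]
          have : (cx * N)⁻¹ * (cx * ((j : ℝ) + 1)) = (j + 1) / N := by field_simp
          rw [this, le_div_iff₀ hNp]
          exact h2
        have hVe : V j ω = D * N⁻¹ := by
          simp only [hV]
          rw [hφ1, one_mul]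
        have h3 : D * (1 / N) ≤ (c1 + c2)⁻¹ * N⁻¹ := by
          rw [one_div]
          exact mul_le_mul_of_nonneg_right (D1 ω) (by positivity)
        have h4 := mul_le_mul_of_nonneg_left hv hDp.le
        calc V j ω * (a j ω * b j ω / (N ^ 2 * (N + 1)) + 1 / (cx * (j + 1)))
            = N⁻¹ * (D * (a j ω * b j ω / (N ^ 2 * (N + 1))) + D * (1 / (cx * (j + 1)))) := by
              rw [hVe]; ring
          _ ≤ N⁻¹ * ((c1 + c2)⁻¹ * N⁻¹ + cx⁻¹ * N⁻¹) := by
              apply mul_le_mul_of_nonneg_left _ (by positivity)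
              linarith
          _ = C3 * ((N ^ 2)⁻¹ * (ε ^ 2 / 4)) := by
              rw [hC3]; field_simp
          _ ≤ C3 * tipg a b q j ω := mul_le_mul_of_nonneg_left hgl hC30
      · have : V j ω = 0 := by simp [hV, hφ, h]
        simp only [this, zero_mul]
        exact mul_nonneg hC30 (H.g0 j ω)
  have hhi : ∀ j, Integrable (fun ω => V j ω * max (X j ω - T j ω) 0) P := by
    intro j
    have m1 := (Vm j).mono (H.hT j).le le_rfl
    have m2 := (H.hT j).meas
    have m3 := (H.hX j).meas
    refine tip_bddint (C := (c1 + c2)⁻¹ * c0⁻¹) (by fun_prop) ?_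
    filter_upwards [H.supp] with ω hω
    have hd := hω j
    refine tip_mul_bd (V0 j ω) (V1 j ω) ?_
    rw [abs_of_nonneg (le_max_right _ _)]
    exact max_le (by linarith) zero_le_one
  have hsum : Summable fun j => ∫ ω, V (j + K) ω * max (X (j + K) ω - T (j + K) ω) 0 ∂P := by
    have hs := ((summable_nat_add_iff K).2 H.key.2).mul_left (1 / ε * C3)
    refine Summable.of_nonneg_of_le (fun j => integral_nonneg fun ω =>
      mul_nonneg (V0 _ ω) (le_max_right _ _)) (fun j => ?_) hs
    have h1 := integral_mono (hhi (j + K)) ((hst (j + K)).1.const_mul (1 / ε))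
      (fun ω => hpt (j + K) ω (by omega))
    rw [integral_const_mul] at h1
    have h2 := mul_le_mul_of_nonneg_left ((hst (j + K)).2.trans (hg (j + K) (by omega)))
      (by positivity : 0 ≤ 1 / ε)
    rw [mul_assoc]
    exact h1.trans h2
  have has := tip_as_summable (fun j => Eventually.of_forall fun ω =>
      mul_nonneg (V0 (j + K) ω) (le_max_right (X (j + K) ω - T (j + K) ω) 0))
    (fun j => hhi (j + K)) hsum
  filter_upwards [has] with ω hω
  have h1 := (summable_nat_add_iff (f := fun j => V j ω * max (X j ω - T j ω) 0) K).1 hω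
  have h2 := h1.mul_left (c1 * (a 0 ω + b 0 ω + (c1 + c2)))
  refine h2.congr fun j => ?_
  simp only [hV]
  have hD := D0 ω
  have hne : a 0 ω + b 0 ω + (c1 + c2) ≠ 0 := by
    have := Np 0 ω
    positivity
  have := (Np j ω).ne'
  field_simp
  exact mul_comm _ _

lemma TipY.p01 (H : TipY F G P T a b X A B q c1 c2 c0 cx p) : 0 ≤ p ∧ p ≤ 1 :=
  ⟨ge_of_tendsto' H.hp fun j => (H.hq01 j).1, le_of_tendsto' H.hp fun j => (H.hq01 j).2⟩

lemma TipY.upper [IsProbabilityMeasure P] (H : TipY F G P T a b X A B q c1 c2 c0 cx p)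
    {ε : ℝ} (hε : 0 < ε) :
    ∀ᵐ ω ∂P, ∀ᶠ j in atTop, a j ω / (a j ω + b j ω) ≤ p + ε + ε := by
  filter_upwards [H.exc hε, H.Nlim, H.supp] with ω h1 h2 h3
  have hc0 := H.hc0
  have hc1 := H.hc1
  have hc2 := H.hc2
  have hp := H.p01
  have Np : ∀ j, 0 < a j ω + b j ω := fun j => hc0.trans_le (H.N0 j ω)
  have hE0 : ∀ j, 0 ≤ (if p + ε ≤ a j ω / (a j ω + b j ω) then (1 : ℝ) else 0) *
      (c1 * max (X j ω - T j ω) 0) := fun j =>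
    mul_nonneg (by split_ifs <;> norm_num) (mul_nonneg hc1.le (le_max_right _ _))
  have hk := tip_kron hE0 Np (H.mono ω) h2 h1
  have hdet := tip_det (Z := fun j => (1 - (p + ε)) * a j ω - (p + ε) * b j ω) (D := fun _ => 0)
    (E := fun j => (if p + ε ≤ a j ω / (a j ω + b j ω) then (1 : ℝ) else 0) *
      (c1 * max (X j ω - T j ω) 0)) (N := fun j => a j ω + b j ω)
    (C := max ((1 - (p + ε)) * a 0 ω - (p + ε) * b 0 ω) c1) (C0 := 0) (K := 0)
    (by
      intro k _ hZ
      have hmu : p + ε ≤ a k ω / (a k ω + b k ω) := by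
        rw [le_div_iff₀ (Np k)]; linarith
      rw [if_pos hmu, H.ea, H.eb]
      have n1 := mul_nonneg hc1.le (le_max_right (X k ω - T k ω) 0)
      have n2 := mul_nonneg hc2.le (le_max_right (T k ω - X k ω) 0)
      have n3 := mul_nonneg (by linarith : 0 ≤ p + ε) n1
      have n4 := mul_nonneg (by linarith : 0 ≤ p + ε) n2
      linarith)
    (by
      intro k _ hZ
      refine le_trans ?_ (le_max_right _ _)
      rw [H.ea, H.eb]
      have hd := h3 k
      have m1 : max (X k ω - T k ω) 0 ≤ 1 := max_le (by linarith) zero_le_one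
      have n0 := mul_le_mul_of_nonneg_left m1 hc1.le
      have n1 := mul_nonneg hc1.le (le_max_right (X k ω - T k ω) 0)
      have n2 := mul_nonneg hc2.le (le_max_right (T k ω - X k ω) 0)
      have n3 := mul_nonneg (by linarith : 0 ≤ p + ε) n1
      have n4 := mul_nonneg (by linarith : 0 ≤ p + ε) n2
      linarith)
    (le_max_left _ _) hE0 (by simp) h2 hk
  filter_upwards [hdet ε hε] with j hj
  rw [div_le_iff₀ (Np j)]
  linarith

lemma TipY.mulim [IsProbabilityMeasure P] (H : TipY F G P T a b X A B q c1 c2 c0 cx p) :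
    ∀ᵐ ω ∂P, Tendsto (fun j => a j ω / (a j ω + b j ω)) atTop (nhds p) := by
  have h1 : ∀ᵐ ω ∂P, ∀ i : ℕ, ∀ᶠ j in atTop, a j ω / (a j ω + b j ω)
      ≤ p + 1 / ((i : ℝ) + 1) + 1 / ((i : ℝ) + 1) :=
    ae_all_iff.2 fun i => H.upper (by positivity)
  have h2 : ∀ᵐ ω ∂P, ∀ i : ℕ, ∀ᶠ j in atTop, b j ω / (b j ω + a j ω)
      ≤ (1 - p) + 1 / ((i : ℝ) + 1) + 1 / ((i : ℝ) + 1) :=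
    ae_all_iff.2 fun i => H.swap.upper (by positivity)
  filter_upwards [h1, h2] with ω h1 h2
  rw [tendsto_order]
  constructor
  · intro c hc
    obtain ⟨i, hi⟩ := exists_nat_one_div_lt (show 0 < (p - c) / 2 by linarith)
    filter_upwards [h2 i] with j hj
    have e : b j ω / (b j ω + a j ω) = 1 - a j ω / (a j ω + b j ω) := by
      have := (H.hT j).apos ω
      have := (H.hT j).bpos ω
      field_simp
      ring
    rw [e] at hj
    linarith
  · intro c hc
    obtain ⟨i, hi⟩ := exists_nat_one_div_lt (show 0 < (c - p) / 2 by linarith)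
    filter_upwards [h1 i] with j hj
    linarith
end

lemma tip_cbD {mΩ : MeasurableSpace Ω} {P : Measure Ω} [IsProbabilityMeasure P]
    {ℱ : Filtration ℕ mΩ} {T a b : ℕ → Ω → ℝ} (hT : Adapted ℱ T) (ha : Adapted ℱ a)
    (hb : Adapted ℱ b) (pa : ∀ k ω, 0 < a k ω) (pb : ∀ k ω, 0 < b k ω) {s f : ℝ} {i : ℕ}
    (e : ∀ ω, a (i + 1) ω = a i ω + s ∧ b (i + 1) ω = b i ω + f)
    (law : ∀ A : Set ℝ, MeasurableSet A →
      P[fun ω => A.indicator (fun _ => (1 : ℝ)) (T (i + 1) ω) | ℱ i]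
        =ᵐ[P] fun ω => (betaMeasure (a (i + 1) ω) (b (i + 1) ω) A).toReal) :
    TipCB (ℱ i) P (T (i + 1)) (a (i + 1)) (b (i + 1)) := by
  refine tip_cb (ℱ.le i) ((hT (i + 1)).mono (ℱ.le _) le_rfl) ?_ ?_ (pa _) (pb _) law
  · rw [show a (i + 1) = fun ω => a i ω + s from funext fun ω => (e ω).1]
    exact (ha i).add_const s
  · rw [show b (i + 1) = fun ω => b i ω + f from funext fun ω => (e ω).2]
    exact (hb i).add_const f

lemma tip_cbI {mΩ : MeasurableSpace Ω} {P : Measure Ω} [IsProbabilityMeasure P]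
    {ℱ : Filtration ℕ mΩ} {T a b X : ℕ → Ω → ℝ} (hT : Adapted ℱ T) (ha : Adapted ℱ a)
    (hb : Adapted ℱ b) (hX : Adapted ℱ X)
    (pa : ∀ k ω, 0 < a k ω) (pb : ∀ k ω, 0 < b k ω) {c1 c2 : ℝ} {i : ℕ}
    (e : ∀ ω, a (i + 1) ω = a i ω + c1 * max (X (i + 1) ω - T i ω) 0 ∧
      b (i + 1) ω = b i ω + c2 * max (T i ω - X (i + 1) ω) 0)
    (law : ∀ A : Set ℝ, MeasurableSet A →
      P[fun ω => A.indicator (fun _ => (1 : ℝ)) (T (i + 1) ω)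
          | (ℱ i : MeasurableSpace Ω) ⊔ MeasurableSpace.comap (X (i + 1)) inferInstance]
        =ᵐ[P] fun ω => (betaMeasure (a (i + 1) ω) (b (i + 1) ω) A).toReal) :
    TipCB ((ℱ i : MeasurableSpace Ω) ⊔ MeasurableSpace.comap (X (i + 1)) inferInstance)
      P (T (i + 1)) (a (i + 1)) (b (i + 1)) := by
  have hXm : Measurable (X (i + 1)) := (hX (i + 1)).mono (ℱ.le _) le_rfl
  have l1 : (ℱ i : MeasurableSpace Ω) ≤
    (ℱ i : MeasurableSpace Ω) ⊔ MeasurableSpace.comap (X (i + 1)) inferInstance := le_sup_left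
  have mX : Measurable[(ℱ i : MeasurableSpace Ω) ⊔
      MeasurableSpace.comap (X (i + 1)) inferInstance] (X (i + 1)) :=
    (comap_measurable (X (i + 1))).mono le_sup_right le_rfl
  have mT := (hT i).mono l1 le_rfl
  refine tip_cb (sup_le (ℱ.le i) hXm.comap_le) ((hT (i + 1)).mono (ℱ.le _) le_rfl) ?_ ?_
    (pa _) (pb _) law
  · rw [show a (i + 1) = fun ω => a i ω + c1 * max (X (i + 1) ω - T i ω) 0 from
      funext fun ω => (e ω).1]
    exact ((ha i).mono l1 le_rfl).add (((mX.sub mT).max measurable_const).const_mul c1)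
  · rw [show b (i + 1) = fun ω => b i ω + c2 * max (T i ω - X (i + 1) ω) 0 from
      funext fun ω => (e ω).2]
    exact ((hb i).mono l1 le_rfl).add (((mT.sub mX).max measurable_const).const_mul c2)

lemma tip_low {a : ℕ → Ω → ℝ} {a0 : ℝ} (h0 : ∀ ω, a 0 ω = a0)
    (h : ∀ k ω, a k ω ≤ a (k + 1) ω) (k : ℕ) (ω : Ω) : a0 ≤ a k ω := by
  have := monotone_nat_of_le_succ (f := fun k => a k ω) (fun k => h k ω) (Nat.zero_le k)
  rw [← h0 ω]
  exact this

lemma tip_qlim {a b s f : ℝ} (ha : 0 < a) (hb : 0 < b) (hs : 0 < s) (hf : 0 < f) :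
    Tendsto (fun k : ℕ => (a + k * s) / ((a + k * s) + (b + k * f))) atTop
      (nhds (s / (s + f))) := by
  have h1 : Tendsto (fun k : ℕ => (s + f) * ((a + b) + (k : ℝ) * (s + f))) atTop atTop := by
    apply Tendsto.const_mul_atTop (by positivity)
    apply tendsto_atTop_add_const_left
    exact tendsto_natCast_atTop_atTop.atTop_mul_const (by positivity)
  have h2 := (h1.const_div_atTop (a * f - s * b)).const_add (s / (s + f))
  rw [add_zero] at h2
  refine h2.congr fun k => ?_
  have : (0 : ℝ) ≤ k := Nat.cast_nonneg k
  have e1 : (0 : ℝ) < a + b + k * (s + f) := by positivity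
  have e2 : (0 : ℝ) < (a + k * s) + (b + k * f) := by positivity
  have e3 : (0 : ℝ) < s + f := by positivity
  field_simp
  ring

end TipHelpers

open scoped ENNReal

/-- **Trust convergence in the TIP alternating-interaction model.**
With `m ≥ 1` direct interactions for agent `x` and `n ≥ 0` for agent `y` per turn,
both agents' trust processes `Tx` and `Ty` converge in probability to constants
`tx, ty ∈ [0,1]`. -/
theorem tip_trust_converges_in_probability
    {Ω : Type*} [MeasurableSpace Ω] (P : Measure Ω) [IsProbabilityMeasure P]
    (ℱ : Filtration ℕ ‹MeasurableSpace Ω›)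
    -- parameters
    (r : ℝ) (hr : r ∈ Set.Ioo (0 : ℝ) 1)
    (m n : ℕ) (hm : 1 ≤ m)
    (sx fx sy fy : ℝ) (hsx : 0 < sx) (hfx : 0 < fx) (hsy : 0 < sy) (hfy : 0 < fy)
    (sxh fxh syh fyh : ℝ) (hsxh : 0 < sxh) (hfxh : 0 < fxh) (hsyh : 0 < syh) (hfyh : 0 < fyh)
    (txy tyx : ℝ) (htxy : txy ∈ Set.Ioc (0 : ℝ) 1) (htyx : tyx ∈ Set.Ioc (0 : ℝ) 1)
    (ax0 bx0 ay0 by0 : ℝ) (hax0 : 0 < ax0) (hbx0 : 0 < bx0) (hay0 : 0 < ay0) (hby0 : 0 < by0)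
    -- processes
    (ax bx ay bY : ℕ → Ω → ℝ) (Tx Ty : ℕ → Ω → ℝ)
    (hax_init : ∀ ω, ax 0 ω = ax0) (hbx_init : ∀ ω, bx 0 ω = bx0)
    (hay_init : ∀ ω, ay 0 ω = ay0) (hbY_init : ∀ ω, bY 0 ω = by0)
    -- all processes are adapted to the filtration
    (hax_adapted : Adapted ℱ ax) (hbx_adapted : Adapted ℱ bx)
    (hay_adapted : Adapted ℱ ay) (hbY_adapted : Adapted ℱ bY)
    (hTx_adapted : Adapted ℱ Tx) (hTy_adapted : Adapted ℱ Ty)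
    -- update equations at x-steps: x updates directly, y indirectly
    (hxstep : ∀ k, 1 ≤ k → (k - 1) % (m + n) < m → ∀ ω,
      ax k ω = ax (k - 1) ω + sx * r ∧
      bx k ω = bx (k - 1) ω + fx * (1 - r) ∧
      ay k ω = ay (k - 1) ω + syh * tyx * max (Tx k ω - Ty (k - 1) ω) 0 ∧
      bY k ω = bY (k - 1) ω + fyh * tyx * max (Ty (k - 1) ω - Tx k ω) 0)
    -- update equations at y-steps: y updates directly, x indirectly
    (hystep : ∀ k, 1 ≤ k → ¬ (k - 1) % (m + n) < m → ∀ ω,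
      ay k ω = ay (k - 1) ω + sy * r ∧
      bY k ω = bY (k - 1) ω + fy * (1 - r) ∧
      ax k ω = ax (k - 1) ω + sxh * txy * max (Ty k ω - Tx (k - 1) ω) 0 ∧
      bx k ω = bx (k - 1) ω + fxh * txy * max (Tx (k - 1) ω - Ty k ω) 0)
    -- at an x-step, the conditional distribution of `Tx k` given the past is
    -- Beta(ax k, bx k), and that of `Ty k` given the past and `Tx k` is Beta(ay k, bY k)
    (hTx_condLaw_xstep : ∀ k, 1 ≤ k → (k - 1) % (m + n) < m → ∀ A : Set ℝ, MeasurableSet A →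
      P[fun ω => A.indicator (fun _ => (1 : ℝ)) (Tx k ω) | ℱ (k - 1)]
        =ᵐ[P] fun ω => (betaMeasure (ax k ω) (bx k ω) A).toReal)
    (hTy_condLaw_xstep : ∀ k, 1 ≤ k → (k - 1) % (m + n) < m → ∀ A : Set ℝ, MeasurableSet A →
      P[fun ω => A.indicator (fun _ => (1 : ℝ)) (Ty k ω)
          | (ℱ (k - 1) : MeasurableSpace Ω) ⊔ MeasurableSpace.comap (Tx k) inferInstance]
        =ᵐ[P] fun ω => (betaMeasure (ay k ω) (bY k ω) A).toReal)
    -- at a y-step, symmetrically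
    (hTy_condLaw_ystep : ∀ k, 1 ≤ k → ¬ (k - 1) % (m + n) < m → ∀ A : Set ℝ, MeasurableSet A →
      P[fun ω => A.indicator (fun _ => (1 : ℝ)) (Ty k ω) | ℱ (k - 1)]
        =ᵐ[P] fun ω => (betaMeasure (ay k ω) (bY k ω) A).toReal)
    (hTx_condLaw_ystep : ∀ k, 1 ≤ k → ¬ (k - 1) % (m + n) < m → ∀ A : Set ℝ, MeasurableSet A →
      P[fun ω => A.indicator (fun _ => (1 : ℝ)) (Tx k ω)
          | (ℱ (k - 1) : MeasurableSpace Ω) ⊔ MeasurableSpace.comap (Ty k) inferInstance]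
        =ᵐ[P] fun ω => (betaMeasure (ax k ω) (bx k ω) A).toReal) :
    ∃ tx ty : ℝ, tx ∈ Set.Icc (0 : ℝ) 1 ∧ ty ∈ Set.Icc (0 : ℝ) 1 ∧
      ∀ ε > 0,
        Tendsto (fun k => P {ω | ε < |Tx k ω - tx|}) atTop (nhds 0) ∧
        Tendsto (fun k => P {ω | ε < |Ty k ω - ty|}) atTop (nhds 0) := by
  have hr0 := hr.1
  have hr1 : 0 < 1 - r := by linarith [hr.2]
  have htxy0 := htxy.1
  have htyx0 := htyx.1
  have X' : ∀ i, i % (m + n) < m → ∀ ω,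
      (ax (i + 1) ω = ax i ω + sx * r ∧ bx (i + 1) ω = bx i ω + fx * (1 - r)) ∧
      (ay (i + 1) ω = ay i ω + syh * tyx * max (Tx (i + 1) ω - Ty i ω) 0 ∧
      bY (i + 1) ω = bY i ω + fyh * tyx * max (Ty i ω - Tx (i + 1) ω) 0) := by
    intro i hi ω
    obtain ⟨h1, h2, h3, h4⟩ := hxstep (i + 1) (by omega) hi ω
    exact ⟨⟨h1, h2⟩, h3, h4⟩
  have Y' : ∀ i, ¬ i % (m + n) < m → ∀ ω,
      (ay (i + 1) ω = ay i ω + sy * r ∧ bY (i + 1) ω = bY i ω + fy * (1 - r)) ∧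
      (ax (i + 1) ω = ax i ω + sxh * txy * max (Ty (i + 1) ω - Tx i ω) 0 ∧
      bx (i + 1) ω = bx i ω + fxh * txy * max (Tx i ω - Ty (i + 1) ω) 0) := by
    intro i hi ω
    obtain ⟨h1, h2, h3, h4⟩ := hystep (i + 1) (by omega) hi ω
    exact ⟨⟨h1, h2⟩, h3, h4⟩
  have pX1 : 0 < sx * r := by positivity
  have pX2 : 0 < fx * (1 - r) := by positivity
  have pX3 : 0 < sxh * txy := by positivity
  have pX4 : 0 < fxh * txy := by positivity
  have pY1 : 0 < sy * r := by positivity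
  have pY2 : 0 < fy * (1 - r) := by positivity
  have pY3 : 0 < syh * tyx := by positivity
  have pY4 : 0 < fyh * tyx := by positivity
  have lax : ∀ k ω, ax0 ≤ ax k ω := tip_low hax_init fun k ω => by
    by_cases h : k % (m + n) < m
    · linarith [(X' k h ω).1.1]
    · linarith [(Y' k h ω).2.1, mul_nonneg pX3.le (le_max_right (Ty (k + 1) ω - Tx k ω) 0)]
  have lbx : ∀ k ω, bx0 ≤ bx k ω := tip_low hbx_init fun k ω => by
    by_cases h : k % (m + n) < m
    · linarith [(X' k h ω).1.2]
    · linarith [(Y' k h ω).2.2, mul_nonneg pX4.le (le_max_right (Tx k ω - Ty (k + 1) ω) 0)]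
  have lay : ∀ k ω, ay0 ≤ ay k ω := tip_low hay_init fun k ω => by
    by_cases h : k % (m + n) < m
    · linarith [(X' k h ω).2.1, mul_nonneg pY3.le (le_max_right (Tx (k + 1) ω - Ty k ω) 0)]
    · linarith [(Y' k h ω).1.1]
  have lby : ∀ k ω, by0 ≤ bY k ω := tip_low hbY_init fun k ω => by
    by_cases h : k % (m + n) < m
    · linarith [(X' k h ω).2.2, mul_nonneg pY4.le (le_max_right (Ty k ω - Tx (k + 1) ω) 0)]
    · linarith [(Y' k h ω).1.2]
  have pax : ∀ k ω, 0 < ax k ω := fun k ω => hax0.trans_le (lax k ω)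
  have pbx : ∀ k ω, 0 < bx k ω := fun k ω => hbx0.trans_le (lbx k ω)
  have pay : ∀ k ω, 0 < ay k ω := fun k ω => hay0.trans_le (lay k ω)
  have pby : ∀ k ω, 0 < bY k ω := fun k ω => hby0.trans_le (lby k ω)
  have CX1 : ∀ i, i % (m + n) < m → TipCB (ℱ i) P (Tx (i + 1)) (ax (i + 1)) (bx (i + 1)) :=
    fun i hi => tip_cbD hTx_adapted hax_adapted hbx_adapted pax pbx (fun ω => (X' i hi ω).1)
      (hTx_condLaw_xstep (i + 1) (by omega) hi)
  have CY1 : ∀ i, i % (m + n) < m →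
      TipCB ((ℱ i : MeasurableSpace Ω) ⊔ MeasurableSpace.comap (Tx (i + 1)) inferInstance)
        P (Ty (i + 1)) (ay (i + 1)) (bY (i + 1)) :=
    fun i hi => tip_cbI hTy_adapted hay_adapted hbY_adapted hTx_adapted pay pby
      (fun ω => (X' i hi ω).2) (hTy_condLaw_xstep (i + 1) (by omega) hi)
  have CY2 : ∀ i, ¬ i % (m + n) < m → TipCB (ℱ i) P (Ty (i + 1)) (ay (i + 1)) (bY (i + 1)) :=
    fun i hi => tip_cbD hTy_adapted hay_adapted hbY_adapted pay pby (fun ω => (Y' i hi ω).1)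
      (hTy_condLaw_ystep (i + 1) (by omega) hi)
  have CX2 : ∀ i, ¬ i % (m + n) < m →
      TipCB ((ℱ i : MeasurableSpace Ω) ⊔ MeasurableSpace.comap (Ty (i + 1)) inferInstance)
        P (Tx (i + 1)) (ax (i + 1)) (bx (i + 1)) :=
    fun i hi => tip_cbI hTx_adapted hax_adapted hbx_adapted hTy_adapted pax pbx
      (fun ω => (Y' i hi ω).2) (hTx_condLaw_ystep (i + 1) (by omega) hi)
  have CX : ∀ k, ∃ G : MeasurableSpace Ω, 1 ≤ k → TipCB G P (Tx k) (ax k) (bx k) := by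
    intro k
    rcases k with _ | i
    · exact ⟨⊥, fun h => absurd h (by omega)⟩
    · by_cases hi : i % (m + n) < m
      · exact ⟨_, fun _ => CX1 i hi⟩
      · exact ⟨_, fun _ => CX2 i hi⟩
  have CY : ∀ k, ∃ G : MeasurableSpace Ω, 1 ≤ k → TipCB G P (Ty k) (ay k) (bY k) := by
    intro k
    rcases k with _ | i
    · exact ⟨⊥, fun h => absurd h (by omega)⟩
    · by_cases hi : i % (m + n) < m
      · exact ⟨_, fun _ => CY1 i hi⟩
      · exact ⟨_, fun _ => CY2 i hi⟩
  choose GX hGX using CX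
  choose GY hGY using CY
  rcases Nat.eq_zero_or_pos n with hn | hn
  · have all : ∀ i, i % (m + n) < m := fun i => by
      rw [hn, add_zero]
      exact Nat.mod_lt _ (by omega)
    have eax : ∀ k ω, ax k ω = ax0 + k * (sx * r) := by
      intro k ω
      induction k with
      | zero => simp [hax_init]
      | succ k ih => rw [(X' k (all k) ω).1.1, ih]; push_cast; ring
    have ebx : ∀ k ω, bx k ω = bx0 + k * (fx * (1 - r)) := by
      intro k ω
      induction k with
      | zero => simp [hbx_init]
      | succ k ih => rw [(X' k (all k) ω).1.2, ih]; push_cast; ring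
    have ql := tip_qlim hax0 hbx0 pX1 pX2
    have HY : TipY (fun j => (ℱ (j + 1) : MeasurableSpace Ω))
        (fun j => (ℱ j : MeasurableSpace Ω) ⊔ MeasurableSpace.comap (Tx (j + 1)) inferInstance) P
        (fun j => Ty (j + 1)) (fun j => ay (j + 1)) (fun j => bY (j + 1))
        (fun j => Tx (j + 2)) (fun j => ax (j + 2)) (fun j => bx (j + 2))
        (fun j => (ax0 + ((j + 2 : ℕ) : ℝ) * (sx * r)) / ((ax0 + ((j + 2 : ℕ) : ℝ) * (sx * r)) +
          (bx0 + ((j + 2 : ℕ) : ℝ) * (fx * (1 - r)))))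
        (syh * tyx) (fyh * tyx) (min ay0 by0) (sx * r + fx * (1 - r))
        (sx * r / (sx * r + fx * (1 - r))) :=
      { hT := fun j => CY1 j (all j)
        hX := fun j => CX1 (j + 1) (all _)
        GF := fun j => sup_le (ℱ.mono (Nat.le_succ j)) (hTx_adapted (j + 1)).comap_le
        FG := fun j => le_sup_left
        Tm := fun j => hTy_adapted (j + 1)
        ea := fun j ω => (X' (j + 1) (all _) ω).2.1
        eb := fun j ω => (X' (j + 1) (all _) ω).2.2
        hc1 := pY3
        hc2 := pY4
        hc0 := lt_min hay0 hby0
        hcx := by positivity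
        ha := fun j ω => (min_le_left _ _).trans (lay _ ω)
        hb := fun j ω => (min_le_right _ _).trans (lby _ ω)
        hAN := fun j ω => by
          rw [eax, ebx]
          push_cast
          nlinarith
        hq := fun j ω => by rw [eax, ebx]
        hq01 := fun j => by
          have h2 : (0 : ℝ) ≤ ((j + 2 : ℕ) : ℝ) := Nat.cast_nonneg _
          refine ⟨by positivity, ?_⟩
          rw [div_le_one (by positivity)]
          have : 0 ≤ bx0 + ((j + 2 : ℕ) : ℝ) * (fx * (1 - r)) := by positivity
          linarith
        hp := ql.comp (tendsto_add_atTop_nat 2) }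
    refine ⟨_, _, HY.p01, HY.p01, fun ε hε => ⟨?_, ?_⟩⟩
    · refine tip_inprob (c := ax0 + bx0) (by positivity) hGX
        (fun k ω _ => add_le_add (lax k ω) (lbx k ω)) (Eventually.of_forall fun ω => ?_)
        (Eventually.of_forall fun ω => ?_) ε hε
      · simp only [eax, ebx]
        have : Tendsto (fun k : ℕ => (ax0 + bx0) + (k : ℝ) * (sx * r + fx * (1 - r))) atTop atTop := by
          apply tendsto_atTop_add_const_left
          exact tendsto_natCast_atTop_atTop.atTop_mul_const (by positivity)
        refine this.congr fun k => ?_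
        ring
      · simp only [eax, ebx]
        exact ql
    · refine tip_inprob (c := ay0 + by0) (by positivity) hGY
        (fun k ω _ => add_le_add (lay k ω) (lby k ω)) ?_ ?_ ε hε
      · filter_upwards [HY.Nlim] with ω hω
        exact (tendsto_add_atTop_iff_nat (f := fun k => ay k ω + bY k ω) 1).1 hω
      · filter_upwards [HY.mulim] with ω hω
        exact (tendsto_add_atTop_iff_nat (f := fun k => ay k ω / (ay k ω + bY k ω)) 1).1 hω
  · exact tip_case_pos hm hn pX1 pX2 pX3 pX4 pY1 pY2 pY3 pY4 hax0 hbx0 hay0 hby0 hGX hGY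
      lax lbx lay lby (fun k ω h => (X' k h ω).1) (fun k ω h => (Y' k h ω).2)
      (fun k ω h => (Y' k h ω).1) (fun k ω h => (X' k h ω).2)
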